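/- Let M be a finite labeled MDP, u a state, and B a boolean combination of predicates of the form Pr^σ_u(φ_i) Δ p_i, where each φ_i is an ω-regular property, Δ ∈ {≤, ≥, <, >, =}, and p_i ∈ [0,1]. If there exists any strategy σ satisfying B, then there exists a strategy satisfying B that is implementable with a finite amount of memory: a randomized strategy whose choice of action distribution depends only on the current state together with a memory value ranging over a finite set that is updated (possibly randomly) along the trajectory. -/

import Mathlib

open scoped BigOperators
open MeasureTheory

/-- A finite-state Markov decision process: a finite set of states `V`, a finite
action alphabet `A`, a nonempty set of enabled actions at each state, and for each
state and enabled action a probability distribution on next states. -/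
structure MDP (V A : Type) [Fintype V] [Fintype A] where
  enabled : V → Finset A
  enabled_nonempty : ∀ v, (enabled v).Nonempty
  p : V → A → V → ℝ
  p_nonneg : ∀ v a v', 0 ≤ p v a v'
  p_sum : ∀ v, ∀ a ∈ enabled v, ∑ v', p v a v' = 1

namespace MDP

variable {V A : Type} [Fintype V] [Fintype A]

/-- A (history-dependent, randomized) strategy: given the list of past
(state, action) pairs (most recent first) and the current state, a probability
distribution on actions, supported on the enabled actions. -/
structure Strategy (M : MDP V A) where
  act : List (V × A) → V → A → ℝ
  act_nonneg : ∀ h v a, 0 ≤ act h v a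
  act_support : ∀ h v a, a ∉ M.enabled v → act h v a = 0
  act_sum : ∀ h v, ∑ a, act h v a = 1

/-- A strategy is memoryless (stationary) if it depends only on the current state. -/
def Strategy.Memoryless {M : MDP V A} (σ : M.Strategy) : Prop :=
  ∀ h h' v, σ.act h v = σ.act h' v

/-- A strategy is pure (deterministic) if it always plays a single action with
probability 1. -/
def Strategy.Pure {M : MDP V A} (σ : M.Strategy) : Prop :=
  ∀ h v, ∃ a, σ.act h v a = 1

/-- `α` is a probability distribution on `V`. -/
def IsDist (α : V → ℝ) : Prop :=
  (∀ v, 0 ≤ α v) ∧ ∑ v, α v = 1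

/-- The point (Dirac) distribution at `u`. -/
def diracD [DecidableEq V] (u : V) : V → ℝ := fun v => if v = u then 1 else 0

/-- The `m`-th binary digit of `x`. -/
noncomputable def bit (m : ℕ) (x : ℝ) : ℝ :=
  if ⌊x * 2 ^ (m + 1)⌋ % 2 = 1 then 1 else 0

/-- Extracts from a single seed `x ∈ [0,1]` a sequence of independent uniform
`[0,1]` samples, by splitting the binary digits of `x`. -/
noncomputable def unif (k : ℕ) (x : ℝ) : ℝ :=
  ∑' n : ℕ, bit (Nat.pair k n) x / 2 ^ (n + 1)

/-- Inverse-CDF sampling from a distribution `q` on a finite type, using the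
uniform sample `u`. -/
noncomputable def sample {S : Type} [Fintype S] [Nonempty S] (q : S → ℝ) (u : ℝ) : S :=
  let e := Fintype.equivFin S
  if h : (Finset.univ.filter fun i => u < ∑ j ∈ Finset.Iic i, q (e.symm j)).Nonempty then
    e.symm ((Finset.univ.filter fun i => u < ∑ j ∈ Finset.Iic i, q (e.symm j)).min' h)
  else Classical.arbitrary S

variable [Nonempty V] [Nonempty A]

/-- The random run of `M` under strategy `σ` from initial distribution `α`, driven by
the random seed `x`: at time `n` it returns the list of past (state, action) pairs
(most recent first) together with the current state and the action chosen there. -/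
noncomputable def run (M : MDP V A) (σ : M.Strategy) (α : V → ℝ) (x : ℝ) :
    ℕ → List (V × A) × (V × A)
  | 0 =>
      let s := sample α (unif 0 x)
      ([], (s, sample (σ.act [] s) (unif 1 x)))
  | n + 1 =>
      let r := run M σ α x n
      let s' := sample (M.p r.2.1 r.2.2) (unif (2 * n + 2) x)
      (r.2 :: r.1, (s', sample (σ.act (r.2 :: r.1) s') (unif (2 * n + 3) x)))

/-- The state at time `n` of the run driven by seed `x`. -/
noncomputable def stateAt (M : MDP V A) (σ : M.Strategy) (α : V → ℝ) (x : ℝ) (n : ℕ) : V :=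
  (M.run σ α x n).2.1

/-- The probability, under strategy `σ` from initial distribution `α`, that the
infinite trajectory of states belongs to the event `E`. -/
noncomputable def PrEvent (M : MDP V A) (σ : M.Strategy) (α : V → ℝ) (E : Set (ℕ → V)) : ℝ :=
  (volume {x : ℝ | x ∈ Set.Icc (0 : ℝ) 1 ∧ M.stateAt σ α x ∈ E}).toReal

/-- The probability of eventually visiting the set `F` (the event `◇F`). -/
noncomputable def PrReach (M : MDP V A) (σ : M.Strategy) (α : V → ℝ) (F : Set V) : ℝ :=
  M.PrEvent σ α {w | ∃ n, w n ∈ F}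

/-- A state is absorbing if it has a single enabled action, which loops on it with
probability 1. -/
def Absorbing (M : MDP V A) (v : V) : Prop :=
  ∃ a, M.enabled v = {a} ∧ M.p v a v = 1

/-- One positive-probability step of the underlying graph of the MDP. -/
def Step (M : MDP V A) (v v' : V) : Prop :=
  ∃ a ∈ M.enabled v, 0 < M.p v a v'

/-- The MDP is cleaned-up w.r.t. `F`: from every state there is a path of
positive-probability transitions reaching `F`. -/
def CleanedUp (M : MDP V A) (F : Set V) : Prop :=
  ∀ v, ∃ w ∈ F, Relation.ReflTransGen M.Step v w

end MDP

/-- A nondeterministic Büchi automaton over the alphabet `S`, with states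
`Fin (n + 1)`. -/
structure NBA (S : Type) where
  n : ℕ
  start : Finset (Fin (n + 1))
  trans : Fin (n + 1) → S → Fin (n + 1) → Prop
  accept : Finset (Fin (n + 1))

/-- The ω-language accepted by a Büchi automaton: the infinite words admitting a run
that starts in an initial state, respects the transition relation, and visits an
accepting state infinitely often. -/
def NBA.lang {S : Type} (B : NBA S) : Set (ℕ → S) :=
  {w | ∃ ρ : ℕ → Fin (B.n + 1), ρ 0 ∈ B.start ∧
    (∀ i, B.trans (ρ i) (w i) (ρ (i + 1))) ∧
    ∀ N : ℕ, ∃ m : ℕ, N ≤ m ∧ ρ m ∈ B.accept}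

/-- An ω-language over `S` is ω-regular if it is accepted by some (nondeterministic)
Büchi automaton. -/
def IsOmegaRegular {S : Type} (L : Set (ℕ → S)) : Prop :=
  ∃ B : NBA S, B.lang = L

namespace MDP

variable {V A : Type} [Fintype V] [Fintype A] [Nonempty V] [Nonempty A]

/-- The probability, under strategy `σ` from initial state `u` of the MDP labeled by
`ℓ`, that the sequence of labels of the trajectory belongs to the ω-language `L`. -/
noncomputable def PrOmega [DecidableEq V] {S : Type} (M : MDP V A) (σ : M.Strategy)
    (u : V) (ℓ : V → S) (L : Set (ℕ → S)) : ℝ :=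
  M.PrEvent σ (diracD u) {w | (fun n => ℓ (w n)) ∈ L}

end MDP

namespace MDP

variable {V A : Type} [Fintype V] [Fintype A]

/-- A finite-memory (randomized) strategy: a finite memory set `Fin (m+1)`, an initial
memory value, an action distribution depending only on the current state and the
memory value, and a (possibly randomized) memory update performed along each
transition. -/
structure FinMem (M : MDP V A) where
  m : ℕ
  init : Fin (m + 1)
  actF : Fin (m + 1) → V → A → ℝ
  actF_nonneg : ∀ q v a, 0 ≤ actF q v a
  actF_support : ∀ q v a, a ∉ M.enabled v → actF q v a = 0
  actF_sum : ∀ q v, ∑ a, actF q v a = 1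
  upd : Fin (m + 1) → V → A → V → Fin (m + 1) → ℝ
  upd_nonneg : ∀ q v a v' q', 0 ≤ upd q v a v' q'
  upd_sum : ∀ q v a v', ∑ q', upd q v a v' q' = 1

variable [Nonempty V] [Nonempty A]

/-- The random run of `M` controlled by the finite-memory strategy `C` from initial
state `u`, driven by the seed `x`: at time `n` it returns the current state, current
memory value, and the action chosen there. -/
noncomputable def runFM (M : MDP V A) (C : M.FinMem) (u : V) (x : ℝ) :
    ℕ → (V × Fin (C.m + 1)) × A
  | 0 => ((u, C.init), sample (C.actF C.init u) (unif 0 x))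
  | n + 1 =>
      let r := runFM M C u x n
      let v' := sample (M.p r.1.1 r.2) (unif (3 * n + 1) x)
      let q' := sample (C.upd r.1.2 r.1.1 r.2 v') (unif (3 * n + 2) x)
      ((v', q'), sample (C.actF q' v') (unif (3 * n + 3) x))

/-- The probability that the state trajectory under the finite-memory strategy `C`
from `u` belongs to the event `E`. -/
noncomputable def PrEventFM (M : MDP V A) (C : M.FinMem) (u : V) (E : Set (ℕ → V)) : ℝ :=
  (MeasureTheory.volume
    {x : ℝ | x ∈ Set.Icc (0 : ℝ) 1 ∧ (fun n => (M.runFM C u x n).1.1) ∈ E}).toReal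

/-- The probability that the label sequence of the trajectory under the finite-memory
strategy `C` from `u` belongs to the ω-language `L`. -/
noncomputable def PrOmegaFM {S : Type} (M : MDP V A) (C : M.FinMem) (u : V)
    (ℓ : V → S) (L : Set (ℕ → S)) : ℝ :=
  M.PrEventFM C u {w | (fun n => ℓ (w n)) ∈ L}

end MDP

/-- A comparison operator `Δ ∈ {≤, ≥, <, >, =}`. -/
inductive Cmp
  | le | ge | lt | gt | eq

/-- The relation denoted by a comparison operator. -/
def Cmp.rel : Cmp → ℝ → ℝ → Prop
  | .le, a, b => a ≤ b
  | .ge, a, b => b ≤ a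
  | .lt, a, b => a < b
  | .gt, a, b => b < a
  | .eq, a, b => a = b

namespace MDP

open MeasureTheory ProbabilityTheory Filter

set_option linter.unusedSectionVars false

/-- The law of the random seed. -/
noncomputable def seedMeasure : Measure ℝ := volume.restrict (Set.Icc (0 : ℝ) 1)

instance : IsProbabilityMeasure seedMeasure := ⟨by simp [seedMeasure]⟩

lemma seedMeasure_eq_Ico : seedMeasure = volume.restrict (Set.Ico (0 : ℝ) 1) :=
  Measure.restrict_congr_set Ico_ae_eq_Icc.symm

lemma measurable_bit (m : ℕ) : Measurable (bit m) := by
  unfold bit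
  refine Measurable.ite ?_ measurable_const measurable_const
  have h : Measurable fun x : ℝ => ⌊x * 2 ^ (m + 1)⌋ := by fun_prop
  exact h (MeasurableSet.of_discrete (s := {z : ℤ | z % 2 = 1}))

open Classical in
lemma seedMeasure_floor (N : ℕ) (K : Set ℤ) :
    seedMeasure {x | ⌊x * 2 ^ N⌋ ∈ K} =
      ((Finset.range (2 ^ N)).filter fun k : ℕ => (k : ℤ) ∈ K).card * (2⁻¹ : ENNReal) ^ N := by
  have h2 : (0 : ℝ) < 2 ^ N := by positivity
  rw [seedMeasure_eq_Ico, Measure.restrict_apply' measurableSet_Ico]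
  have hset : {x : ℝ | ⌊x * 2 ^ N⌋ ∈ K} ∩ Set.Ico 0 1 =
      ⋃ k ∈ (Finset.range (2 ^ N)).filter (fun k : ℕ => (k : ℤ) ∈ K),
        Set.Ico ((k : ℝ) / 2 ^ N) ((k + 1 : ℝ) / 2 ^ N) := by
    ext x
    simp only [Set.mem_inter_iff, Set.mem_ofPred_eq, Set.mem_Ico, Finset.mem_filter,
      Finset.mem_range, Set.mem_iUnion, exists_prop]
    constructor
    · rintro ⟨hK, h0, h1⟩
      have hf0 : 0 ≤ ⌊x * 2 ^ N⌋ := Int.floor_nonneg.2 (by positivity)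
      obtain ⟨k, hk⟩ := Int.eq_ofNat_of_zero_le hf0
      have hle := Int.floor_le (x * 2 ^ N)
      have hlt := Int.lt_floor_add_one (x * 2 ^ N)
      rw [hk] at hle hlt hK
      push_cast at hle hlt
      refine ⟨k, ⟨?_, hK⟩, ?_, ?_⟩
      · have : (k : ℝ) < 2 ^ N := by nlinarith
        exact_mod_cast this
      · rw [div_le_iff₀ h2]; exact hle
      · rw [lt_div_iff₀ h2]; exact hlt
    · rintro ⟨k, ⟨hk, hK⟩, h0, h1⟩
      rw [div_le_iff₀ h2] at h0
      rw [lt_div_iff₀ h2] at h1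
      have hfl : ⌊x * 2 ^ N⌋ = (k : ℤ) := by
        rw [Int.floor_eq_iff]; push_cast; exact ⟨h0, h1⟩
      refine ⟨by rw [hfl]; exact hK, ?_, ?_⟩
      · by_contra hx
        have : (0 : ℝ) ≤ k := by positivity
        nlinarith [not_le.1 hx]
      · have : (k : ℝ) + 1 ≤ 2 ^ N := by exact_mod_cast hk
        by_contra hx
        nlinarith [not_lt.1 hx]
  rw [hset, measure_biUnion_finset]
  · have : ∀ k : ℕ, volume (Set.Ico ((k : ℝ) / 2 ^ N) ((k + 1 : ℝ) / 2 ^ N)) =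
        (2⁻¹ : ENNReal) ^ N := by
      intro k
      rw [Real.volume_Ico, ← sub_div, add_sub_cancel_left, one_div,
        ENNReal.ofReal_inv_of_pos h2, ENNReal.ofReal_pow (by norm_num), ENNReal.inv_pow]
      simp
    simp [this]
  · intro i _ j _ hij
    rw [Function.onFun, Set.disjoint_left]
    rintro x ⟨h0, h1⟩ ⟨h2', h3⟩
    rw [div_le_iff₀ h2] at h0 h2'
    rw [lt_div_iff₀ h2] at h1 h3
    have a : (i : ℝ) < j + 1 := by linarith
    have b : (j : ℝ) < i + 1 := by linarith
    have a' : i < j + 1 := by exact_mod_cast a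
    have b' : j < i + 1 := by exact_mod_cast b
    omega
  · intro _ _; exact measurableSet_Ico

lemma floor_two_mul_div (y : ℝ) : ⌊y * 2⌋ / 2 = ⌊y⌋ := by
  have h1 := Int.floor_le y
  have h2 := Int.lt_floor_add_one y
  have h3 : 2 * ⌊y⌋ ≤ ⌊y * 2⌋ := by rw [Int.le_floor]; push_cast; linarith
  have h4 : ⌊y * 2⌋ < 2 * ⌊y⌋ + 2 := by rw [Int.floor_lt]; push_cast; linarith
  omega

/-- The value of a binary digit as a real number. -/
noncomputable def digitVal (z : ℤ) : ℝ := if z % 2 = 1 then 1 else 0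

lemma bit_eq (m : ℕ) (x : ℝ) : bit m x = digitVal ⌊x * 2 ^ (m + 1)⌋ := rfl

open Classical in
lemma seedMeasure_floor_inter_bit (N : ℕ) (K : Set ℤ) (B : Set ℝ) :
    seedMeasure ({x | ⌊x * 2 ^ N⌋ ∈ K} ∩ bit N ⁻¹' B) =
      seedMeasure {x | ⌊x * 2 ^ N⌋ ∈ K} *
        (((Finset.range 2).filter fun e : ℕ => digitVal e ∈ B).card * 2⁻¹) := by
  have hset : {x : ℝ | ⌊x * 2 ^ N⌋ ∈ K} ∩ bit N ⁻¹' B =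
      {x : ℝ | ⌊x * 2 ^ (N + 1)⌋ ∈ {j : ℤ | j / 2 ∈ K ∧ digitVal j ∈ B}} := by
    ext x
    have : ⌊x * 2 ^ (N + 1)⌋ / 2 = ⌊x * 2 ^ N⌋ := by
      rw [pow_succ, ← mul_assoc, floor_two_mul_div]
    simp [this, bit_eq]
  rw [hset, seedMeasure_floor, seedMeasure_floor]
  have hcard : ((Finset.range (2 ^ (N + 1))).filter fun k : ℕ =>
      (k : ℤ) ∈ {j : ℤ | j / 2 ∈ K ∧ digitVal j ∈ B}).card =
      ((Finset.range (2 ^ N)).filter fun k : ℕ => (k : ℤ) ∈ K).card *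
        ((Finset.range 2).filter fun e : ℕ => digitVal e ∈ B).card := by
    rw [← Finset.card_product]
    refine Finset.card_bij' (fun k _ => (k / 2, k % 2)) (fun p _ => 2 * p.1 + p.2) ?_ ?_ ?_ ?_
    · intro k hk
      simp only [Finset.mem_filter, Finset.mem_range, Set.mem_ofPred_eq, Finset.mem_product] at hk ⊢
      obtain ⟨h1, h2, h3⟩ := hk
      refine ⟨⟨by rw [pow_succ] at h1; omega, by exact_mod_cast h2⟩, by omega, ?_⟩
      simpa [digitVal] using h3
    · rintro ⟨k, e⟩ hk
      simp only [Finset.mem_filter, Finset.mem_range, Set.mem_ofPred_eq, Finset.mem_product] at hk ⊢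
      obtain ⟨⟨h1, h2⟩, h3, h4⟩ := hk
      refine ⟨by rw [pow_succ]; omega, ?_, ?_⟩
      · have : ((2 * k + e : ℕ) : ℤ) / 2 = k := by omega
        rw [this]; exact h2
      · have : ((2 * k + e : ℕ) : ℤ) % 2 = (e : ℤ) % 2 := by omega
        simpa [digitVal, this] using h4
    · intro k _; simp only; omega
    · rintro ⟨k, e⟩ hk
      simp only [Finset.mem_filter, Finset.mem_range, Finset.mem_product] at hk
      simp only [Prod.mk.injEq]; omega
  calc _ = (((((Finset.range (2 ^ N)).filter fun k : ℕ => (k : ℤ) ∈ K).card *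
        ((Finset.range 2).filter fun e : ℕ => digitVal e ∈ B).card : ℕ)) : ENNReal) *
        2⁻¹ ^ (N + 1) := by rw [← hcard]; congr
    _ = _ := by rw [pow_succ]; push_cast; ring

lemma seedMeasure_inter_bit (N : ℕ) (K : Set ℤ) (B : Set ℝ) :
    seedMeasure ({x | ⌊x * 2 ^ N⌋ ∈ K} ∩ bit N ⁻¹' B) =
      seedMeasure {x | ⌊x * 2 ^ N⌋ ∈ K} * seedMeasure (bit N ⁻¹' B) := by
  have h := seedMeasure_floor_inter_bit N Set.univ B
  simp only [Set.mem_univ, Set.ofPred_true, Set.univ_inter, measure_univ, one_mul] at h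
  rw [h, seedMeasure_floor_inter_bit]

open Classical in
lemma seedMeasure_bit (N : ℕ) (B : Set ℝ) :
    seedMeasure (bit N ⁻¹' B) =
      (((Finset.range 2).filter fun e : ℕ => digitVal e ∈ B).card * 2⁻¹) := by
  simpa using seedMeasure_floor_inter_bit N Set.univ B

lemma exists_floor_eq_iInter_bit (N : ℕ) (B : ℕ → Set ℝ) :
    ∃ K : Set ℤ, (⋂ m ∈ Finset.range N, bit m ⁻¹' B m) = {x : ℝ | ⌊x * 2 ^ N⌋ ∈ K} := by
  induction N with
  | zero => exact ⟨Set.univ, by simp⟩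
  | succ N ih =>
    obtain ⟨K, hK⟩ := ih
    refine ⟨{j : ℤ | j / 2 ∈ K ∧ digitVal j ∈ B N}, ?_⟩
    ext x
    have : ⌊x * 2 ^ (N + 1)⌋ / 2 = ⌊x * 2 ^ N⌋ := by
      rw [pow_succ, ← mul_assoc, floor_two_mul_div]
    rw [Finset.range_add_one, Finset.set_biInter_insert, hK]
    simp [this, bit_eq, and_comm]

lemma seedMeasure_iInter_bit (N : ℕ) (B : ℕ → Set ℝ) :
    seedMeasure (⋂ m ∈ Finset.range N, bit m ⁻¹' B m) =
      ∏ m ∈ Finset.range N, seedMeasure (bit m ⁻¹' B m) := by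
  induction N with
  | zero => simp
  | succ N ih =>
    obtain ⟨K, hK⟩ := exists_floor_eq_iInter_bit N B
    rw [Finset.prod_range_succ, ← ih, hK, ← seedMeasure_inter_bit, ← hK,
      Finset.range_add_one, Finset.set_biInter_insert, Set.inter_comm]

lemma iIndepFun_bit : iIndepFun bit seedMeasure := by
  rw [iIndepFun_iff_measure_inter_preimage_eq_mul]
  intro F sets hs
  classical
  obtain ⟨N, hN⟩ := F.exists_nat_subset_range
  have h := seedMeasure_iInter_bit N (fun m => if m ∈ F then sets m else Set.univ)
  have h1 : (⋂ m ∈ Finset.range N, bit m ⁻¹' (if m ∈ F then sets m else Set.univ)) =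
      ⋂ m ∈ F, bit m ⁻¹' sets m := by
    ext x
    simp only [Set.mem_iInter]
    constructor
    · intro hx m hm
      simpa [hm] using hx m (hN hm)
    · intro hx m _
      by_cases hm : m ∈ F
      · simpa [hm] using hx m hm
      · simp [hm]
  rw [h1] at h
  rw [h, ← Finset.prod_subset hN]
  · exact Finset.prod_congr rfl fun m hm => by simp [hm]
  · intro m _ hm
    simp [hm]

lemma identDistrib_bit (m n : ℕ) : seedMeasure.map (bit m) = seedMeasure.map (bit n) := by
  ext B hB
  rw [Measure.map_apply (measurable_bit m) hB, Measure.map_apply (measurable_bit n) hB,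
    seedMeasure_bit, seedMeasure_bit]

lemma tsum_bit {x : ℝ} (h0 : 0 ≤ x) (h1 : x < 1) : ∑' n, bit n x / 2 ^ (n + 1) = x := by
  have hpart : ∀ n, ∑ i ∈ Finset.range n, bit i x / 2 ^ (i + 1) = (⌊x * 2 ^ n⌋ : ℝ) / 2 ^ n := by
    intro n
    induction n with
    | zero =>
      have : ⌊x⌋ = 0 := Int.floor_eq_zero_iff.2 ⟨h0, h1⟩
      simp [this]
    | succ n ih =>
      have h : ⌊x * 2 ^ (n + 1)⌋ / 2 = ⌊x * 2 ^ n⌋ := by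
        rw [pow_succ, ← mul_assoc, floor_two_mul_div]
      have h2 : bit n x = ((⌊x * 2 ^ (n + 1)⌋ % 2 : ℤ) : ℝ) := by
        rw [bit_eq, digitVal]
        rcases Int.emod_two_eq_zero_or_one ⌊x * 2 ^ (n + 1)⌋ with h | h <;> simp [h]
      have h3 := Int.emod_add_mul_ediv ⌊x * 2 ^ (n + 1)⌋ 2
      have h4 : (⌊x * 2 ^ (n + 1)⌋ : ℝ) = bit n x + 2 * ⌊x * 2 ^ n⌋ := by
        rw [h2, ← h]; exact_mod_cast h3.symm
      rw [Finset.sum_range_succ, ih, h4, pow_succ]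
      field_simp
      ring
  refine HasSum.tsum_eq ?_
  rw [hasSum_iff_tendsto_nat_of_nonneg]
  · simp_rw [hpart]
    have hl : Tendsto (fun n : ℕ => x - (1 / 2 : ℝ) ^ n) atTop (nhds x) := by
      simpa using tendsto_const_nhds.sub
        (tendsto_pow_atTop_nhds_zero_of_lt_one (by norm_num : (0 : ℝ) ≤ 1 / 2) (by norm_num))
    refine tendsto_of_tendsto_of_tendsto_of_le_of_le hl tendsto_const_nhds ?_ ?_
    · intro n
      have h2 : (0 : ℝ) < 2 ^ n := by positivity
      have := Int.lt_floor_add_one (x * 2 ^ n)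
      simp only [one_div, inv_pow]
      rw [le_div_iff₀ h2, sub_mul, inv_mul_cancel₀ h2.ne']
      linarith
    · intro n
      have h2 : (0 : ℝ) < 2 ^ n := by positivity
      simp only
      rw [div_le_iff₀ h2]
      exact Int.floor_le _
  · intro n
    rw [bit]
    split_ifs <;> positivity

lemma measurable_binaryExpansion : Measurable fun b : ℕ → ℝ => ∑' n, b n / 2 ^ (n + 1) := by
  fun_prop

lemma map_unif (k : ℕ) : seedMeasure.map (unif k) = seedMeasure := by
  have hi : Function.Injective fun n => Nat.pair k n := fun a b h => by
    simpa using h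
  have h1 : iIndepFun (fun n => bit (Nat.pair k n)) seedMeasure := iIndepFun_bit.precomp hi
  have e1 := h1.map_fun_eq_infinitePi_map (fun n => measurable_bit _)
  have e2 := iIndepFun_bit.map_fun_eq_infinitePi_map measurable_bit
  have e3 : seedMeasure.map (fun x n => bit (Nat.pair k n) x) =
      seedMeasure.map (fun x n => bit n x) := by
    rw [e1, e2]; congr 1; funext n; exact identDistrib_bit _ _
  have m1 : Measurable (fun x n => bit (Nat.pair k n) x) :=
    measurable_pi_lambda _ fun n => measurable_bit _
  have m2 : Measurable (fun x n => bit n x) := measurable_pi_lambda _ fun n => measurable_bit _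
  have e4 := congrArg (Measure.map fun b : ℕ → ℝ => ∑' n, b n / 2 ^ (n + 1)) e3
  rw [Measure.map_map measurable_binaryExpansion m1, Measure.map_map measurable_binaryExpansion m2]
    at e4
  have e5 : seedMeasure.map ((fun b : ℕ → ℝ => ∑' n, b n / 2 ^ (n + 1)) ∘ fun x n => bit n x) =
      seedMeasure.map id := by
    refine Measure.map_congr ?_
    rw [seedMeasure_eq_Ico]
    filter_upwards [ae_restrict_mem measurableSet_Ico] with x hx
    exact tsum_bit hx.1 hx.2
  rw [e5, Measure.map_id] at e4
  exact e4

/-- The information carried by the first `k` uniform samples. -/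
@[reducible]
noncomputable def pastUnif (k : ℕ) : MeasurableSpace ℝ :=
  ⨆ m ∈ {m : ℕ | (Nat.unpair m).1 < k}, MeasurableSpace.comap (bit m) Real.measurableSpace

lemma pastUnif_le (k : ℕ) : pastUnif k ≤ Real.measurableSpace :=
  iSup₂_le fun m _ => (measurable_bit m).comap_le

lemma pastUnif_mono {j k : ℕ} (h : j ≤ k) : pastUnif j ≤ pastUnif k :=
  biSup_mono fun _ hm => lt_of_lt_of_le hm h

lemma measurable_unif_of_comap_le {m' : MeasurableSpace ℝ} (k : ℕ)
    (h : ∀ n, MeasurableSpace.comap (bit (Nat.pair k n)) Real.measurableSpace ≤ m') :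
    Measurable[m', Real.measurableSpace] (unif k) := by
  have : @Measurable ℝ (ℕ → ℝ) m' (@MeasurableSpace.pi ℕ (fun _ => ℝ)
      fun _ => Real.measurableSpace) fun x n => bit (Nat.pair k n) x :=
    @measurable_pi_lambda ℝ ℕ (fun _ => ℝ) m' (fun _ => Real.measurableSpace) _ fun n =>
      (comap_measurable _).mono (h n) le_rfl
  exact measurable_binaryExpansion.comp this

lemma measurable_unif (k : ℕ) : Measurable (unif k) :=
  measurable_unif_of_comap_le k fun _ => (measurable_bit _).comap_le

lemma measurable_unif_pastUnif {j k : ℕ} (h : j < k) :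
    Measurable[pastUnif k, Real.measurableSpace] (unif j) :=
  measurable_unif_of_comap_le j fun n => by
    unfold pastUnif
    exact le_iSup₂_of_le (Nat.pair j n) (by simpa using h) le_rfl

/-- Each uniform sample is independent of the previous ones. -/
lemma seedMeasure_inter_unif {k : ℕ} {G : Set ℝ} (hG : MeasurableSet[pastUnif k] G)
    {B : Set ℝ} (hB : MeasurableSet B) :
    seedMeasure (G ∩ unif k ⁻¹' B) = seedMeasure G * seedMeasure B := by
  have hd : Disjoint {m : ℕ | (Nat.unpair m).1 < k} {m : ℕ | (Nat.unpair m).1 = k} := by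
    rw [Set.disjoint_left]; intro m h1 h2
    simp only [Set.mem_ofPred_eq] at h1 h2; omega
  have hind := indep_iSup_of_disjoint (fun m => (measurable_bit m).comap_le)
    ((iIndepFun_iff_iIndep _ _ _).1 iIndepFun_bit) hd
  have hU : Measurable[⨆ m ∈ {m : ℕ | (Nat.unpair m).1 = k},
      MeasurableSpace.comap (bit m) Real.measurableSpace, Real.measurableSpace] (unif k) :=
    measurable_unif_of_comap_le k fun n => le_iSup₂_of_le (Nat.pair k n) (by simp) le_rfl
  rw [(Indep_iff _ _ _).1 hind G _ hG (hU hB)]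
  congr 1
  conv_rhs => rw [← map_unif k]
  rw [Measure.map_apply (measurable_unif k) hB]

section Sample

variable {S : Type} [Fintype S] [Nonempty S]

lemma sample_eq_iff {q : S → ℝ} (hq : ∀ s, 0 ≤ q s) (hsum : ∑ s, q s = 1) {y : ℝ}
    (h0 : 0 ≤ y) (h1 : y < 1) (s : S) :
    sample q y = s ↔
      ∑ j ∈ Finset.Iio (Fintype.equivFin S s), q ((Fintype.equivFin S).symm j) ≤ y ∧
        y < ∑ j ∈ Finset.Iic (Fintype.equivFin S s), q ((Fintype.equivFin S).symm j) := by
  set e := Fintype.equivFin S with he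
  set I := Finset.univ.filter fun i => y < ∑ j ∈ Finset.Iic i, q (e.symm j) with hI
  have hmono : ∀ A B : Finset (Fin (Fintype.card S)), A ⊆ B →
      ∑ j ∈ A, q (e.symm j) ≤ ∑ j ∈ B, q (e.symm j) := fun A B h =>
    Finset.sum_le_sum_of_subset_of_nonneg h fun _ _ _ => hq _
  have hne : I.Nonempty := by
    have : Nonempty (Fin (Fintype.card S)) := ⟨e (Classical.arbitrary S)⟩
    obtain ⟨m, hm⟩ := Finite.exists_max (id : Fin (Fintype.card S) → Fin (Fintype.card S))
    refine ⟨m, ?_⟩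
    have : Finset.Iic m = Finset.univ := by ext j; simpa using hm j
    simp only [hI, Finset.mem_filter, Finset.mem_univ, true_and, this]
    rw [e.symm.sum_comp, hsum]; exact h1
  have hs : sample q y = e.symm (I.min' hne) := by
    unfold sample
    exact dif_pos hne
  have hmem := Finset.min'_mem I hne
  set i0 := I.min' hne with hi0
  rw [hs, Equiv.symm_apply_eq]
  have hlt : y < ∑ j ∈ Finset.Iic i0, q (e.symm j) := by simpa [hI] using hmem
  have hle : ∑ j ∈ Finset.Iio i0, q (e.symm j) ≤ y := by
    by_contra hcon
    push Not at hcon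
    rcases Finset.eq_empty_or_nonempty (Finset.Iio i0) with h | h
    · rw [h, Finset.sum_empty] at hcon; linarith
    · set i1 := (Finset.Iio i0).max' h
      have h1 : i1 < i0 := Finset.mem_Iio.1 (Finset.max'_mem _ h)
      have h2 : y < ∑ j ∈ Finset.Iic i1, q (e.symm j) := by
        refine hcon.trans_le (hmono _ _ fun j hj => ?_)
        exact Finset.mem_Iic.2 (Finset.le_max' _ _ hj)
      have h3 : i1 ∈ I := by simpa [hI] using h2
      exact absurd (Finset.min'_le I i1 h3) (not_le.2 h1)
  constructor
  · intro h; rw [← h]; exact ⟨hle, hlt⟩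
  · rintro ⟨ha, hb⟩
    rcases lt_trichotomy i0 (e s) with h | h | h
    · exact absurd (hlt.trans_le (hmono _ _ fun j hj =>
        Finset.mem_Iio.2 ((Finset.mem_Iic.1 hj).trans_lt h))) (not_lt.2 ha)
    · exact h
    · exact absurd (hb.trans_le (hmono _ _ fun j hj =>
        Finset.mem_Iio.2 ((Finset.mem_Iic.1 hj).trans_lt h))) (not_lt.2 hle)

lemma measurableSet_sample_eq (q : S → ℝ) (s : S) : MeasurableSet {y | sample q y = s} := by
  classical
  let e := Fintype.equivFin S
  let F : ℝ → Finset (Fin (Fintype.card S)) := fun y =>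
    Finset.univ.filter fun i => y < ∑ j ∈ Finset.Iic i, q (e.symm j)
  let H : Finset (Fin (Fintype.card S)) → S := fun I =>
    if h : I.Nonempty then e.symm (I.min' h) else Classical.arbitrary S
  have hF : ∀ I, MeasurableSet {y | F y = I} := by
    intro I
    have : {y | F y = I} = ⋂ i, {y | y < ∑ j ∈ Finset.Iic i, q (e.symm j) ↔ i ∈ I} := by
      ext y; simp [F, Finset.ext_iff]
    rw [this]
    refine MeasurableSet.iInter fun i => ?_
    by_cases hi : i ∈ I
    · simp only [hi, iff_true]
      exact measurableSet_Iio
    · simp only [hi, iff_false, not_lt]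
      exact measurableSet_Ici
  have : {y | sample q y = s} = ⋃ I ∈ {I | H I = s}, {y | F y = I} := by
    ext y
    simp only [Set.mem_ofPred_eq, Set.mem_iUnion, exists_prop, exists_eq_right']
    rfl
  rw [this]
  exact MeasurableSet.biUnion (Set.to_countable _) fun I _ => hF I

lemma seedMeasure_sample_eq {q : S → ℝ} (hq : ∀ s, 0 ≤ q s) (hsum : ∑ s, q s = 1) (s : S) :
    seedMeasure {y | sample q y = s} = ENNReal.ofReal (q s) := by
  have hsub : ∀ A : Finset (Fin (Fintype.card S)),
      ∑ j ∈ A, q ((Fintype.equivFin S).symm j) ≤ 1 := fun A => by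
    rw [← hsum, ← (Fintype.equivFin S).symm.sum_comp]
    exact Finset.sum_le_sum_of_subset_of_nonneg (Finset.subset_univ _) fun _ _ _ => hq _
  rw [seedMeasure_eq_Ico, Measure.restrict_apply' measurableSet_Ico]
  have : {y | sample q y = s} ∩ Set.Ico 0 1 =
      Set.Ico (∑ j ∈ Finset.Iio (Fintype.equivFin S s), q ((Fintype.equivFin S).symm j))
        (∑ j ∈ Finset.Iic (Fintype.equivFin S s), q ((Fintype.equivFin S).symm j)) := by
    ext y
    simp only [Set.mem_inter_iff, Set.mem_ofPred_eq, Set.mem_Ico]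
    constructor
    · rintro ⟨h, h0, h1⟩; exact (sample_eq_iff hq hsum h0 h1 s).1 h
    · rintro ⟨h, h'⟩
      have h0 : 0 ≤ y := (Finset.sum_nonneg fun _ _ => hq _).trans h
      have h1 : y < 1 := h'.trans_le (hsub _)
      exact ⟨(sample_eq_iff hq hsum h0 h1 s).2 ⟨h, h'⟩, h0, h1⟩
  rw [this, Real.volume_Ico]
  congr 1
  rw [← Finset.Iio_insert, Finset.sum_insert (by simp)]
  simp

lemma measurableSet_sample_unif (q : S → ℝ) (s : S) {j k : ℕ} (h : j < k) :
    MeasurableSet[pastUnif k] {x | sample q (unif j x) = s} :=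
  measurable_unif_pastUnif h (measurableSet_sample_eq q s)

lemma seedMeasure_inter_sample {k : ℕ} {G : Set ℝ} (hG : MeasurableSet[pastUnif k] G) {q : S → ℝ}
    (hq : ∀ s, 0 ≤ q s) (hsum : ∑ s, q s = 1) (s : S) :
    seedMeasure.real (G ∩ {x | sample q (unif k x) = s}) = seedMeasure.real G * q s := by
  have := seedMeasure_inter_unif hG (measurableSet_sample_eq q s)
  rw [seedMeasure_sample_eq hq hsum] at this
  simp only [Measure.real]
  rw [show {x | sample q (unif k x) = s} = unif k ⁻¹' {y | sample q y = s} from rfl, this,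
    ENNReal.toReal_mul, ENNReal.toReal_ofReal (hq s)]

end Sample

/-- The list of the first `n` entries of a sequence, most recent first. -/
def pre {ι : Type*} (f : ℕ → ι) : ℕ → List ι
  | 0 => []
  | n + 1 => f n :: pre f n

@[simp] lemma length_pre {ι : Type*} (f : ℕ → ι) (n : ℕ) : (pre f n).length = n := by
  induction n with
  | zero => rfl
  | succ n ih => simp [pre, ih]

section Run

variable {V A : Type} [Fintype V] [Fintype A]

/-- The distribution of the next state given the history. -/
def nextState (M : MDP V A) (α : V → ℝ) : List (V × A) → V → ℝ
  | [] => α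
  | r :: _ => M.p r.1 r.2

/-- The distribution of the next state and action given the history. -/
def stepKernel (M : MDP V A) (σ : M.Strategy) (α : V → ℝ) (h : List (V × A)) (r : V × A) : ℝ :=
  nextState M α h r.1 * σ.act h r.1 r.2

variable [Nonempty V] [Nonempty A]

/-- The state-action sequence of a run. -/
noncomputable def traj (M : MDP V A) (σ : M.Strategy) (α : V → ℝ) (x : ℝ) (n : ℕ) : V × A :=
  (M.run σ α x n).2

lemma run_fst (M : MDP V A) (σ : M.Strategy) (α : V → ℝ) (x : ℝ) (n : ℕ) :
    (M.run σ α x n).1 = pre (M.traj σ α x) n := by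
  induction n with
  | zero => rfl
  | succ n ih => simp only [run, pre, ih]; rfl

lemma traj_eq (M : MDP V A) (σ : M.Strategy) (α : V → ℝ) (x : ℝ) (n : ℕ) :
    M.traj σ α x n =
      (sample (nextState M α (pre (M.traj σ α x) n)) (unif (2 * n) x),
        sample (σ.act (pre (M.traj σ α x) n)
          (sample (nextState M α (pre (M.traj σ α x) n)) (unif (2 * n) x)))
          (unif (2 * n + 1) x)) := by
  cases n with
  | zero => rfl
  | succ n =>
    conv_lhs => rw [traj, run]
    simp only [run_fst]
    rfl

lemma pre_and_traj_eq_iff (M : MDP V A) (σ : M.Strategy) (α : V → ℝ) (n : ℕ)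
    (h : List (V × A)) (r : V × A) :
    {x | pre (M.traj σ α x) n = h ∧ M.traj σ α x n = r} =
      ({x | pre (M.traj σ α x) n = h} ∩ {x | sample (nextState M α h) (unif (2 * n) x) = r.1}) ∩
        {x | sample (σ.act h r.1) (unif (2 * n + 1) x) = r.2} := by
  ext x
  simp only [Set.mem_ofPred_eq, Set.mem_inter_iff, and_assoc]
  refine and_congr_right fun hp => ?_
  rw [traj_eq, hp, Prod.ext_iff]
  refine and_congr_right fun h1 => ?_
  simp only at h1 ⊢
  rw [h1]

lemma measurableSet_pre_traj_eq (M : MDP V A) (σ : M.Strategy) (α : V → ℝ) (n : ℕ)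
    (h : List (V × A)) : MeasurableSet[pastUnif (2 * n)] {x | pre (M.traj σ α x) n = h} := by
  induction n generalizing h with
  | zero => exact @MeasurableSet.const _ (pastUnif _) ([] = h)
  | succ n ih =>
    cases h with
    | nil => simp [pre]
    | cons r h =>
      have : {x | pre (M.traj σ α x) (n + 1) = r :: h} =
          {x | pre (M.traj σ α x) n = h ∧ M.traj σ α x n = r} := by
        ext x; simp [pre, and_comm]
      rw [this, pre_and_traj_eq_iff]
      refine MeasurableSet.inter (MeasurableSet.inter ?_ ?_) ?_
      · exact pastUnif_mono (by omega) _ (ih h)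
      · exact measurableSet_sample_unif _ _ (by omega)
      · exact measurableSet_sample_unif _ _ (by omega)

lemma seedMeasure_pre_traj_step (M : MDP V A) (σ : M.Strategy) {α : V → ℝ} (hα : IsDist α)
    (n : ℕ) (h : List (V × A)) (r : V × A) :
    seedMeasure.real {x | pre (M.traj σ α x) n = h ∧ M.traj σ α x n = r} =
      seedMeasure.real {x | pre (M.traj σ α x) n = h} * stepKernel M σ α h r := by
  have key : ∀ (n : ℕ) (h : List (V × A)) (r : V × A),
      (∀ v, 0 ≤ nextState M α h v) → ∑ v, nextState M α h v = 1 →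
      seedMeasure.real {x | pre (M.traj σ α x) n = h ∧ M.traj σ α x n = r} =
        seedMeasure.real {x | pre (M.traj σ α x) n = h} * stepKernel M σ α h r := by
    intro n h r h0 h1
    rw [pre_and_traj_eq_iff, seedMeasure_inter_sample _ (σ.act_nonneg h r.1) (σ.act_sum h r.1),
      seedMeasure_inter_sample (measurableSet_pre_traj_eq M σ α n h) h0 h1, stepKernel, mul_assoc]
    refine MeasurableSet.inter ?_ (measurableSet_sample_unif _ _ (by omega))
    exact pastUnif_mono (by omega) _ (measurableSet_pre_traj_eq M σ α n h)
  suffices H : ∀ (n : ℕ) (h : List (V × A)),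
      seedMeasure.real {x | pre (M.traj σ α x) n = h} = 0 ∨
        ((∀ v, 0 ≤ nextState M α h v) ∧ ∑ v, nextState M α h v = 1) by
    rcases H n h with h0 | ⟨h0, h1⟩
    · rw [h0, zero_mul]
      refine le_antisymm ?_ measureReal_nonneg
      rw [← h0]
      exact measureReal_mono fun x hx => hx.1
    · exact key n h r h0 h1
  intro n
  induction n with
  | zero =>
    intro h
    cases h with
    | nil => exact Or.inr hα
    | cons r h => left; simp [pre]
  | succ n ih =>
    intro h
    cases h with
    | nil => left; simp [pre]
    | cons r h =>
      by_cases hr : r.2 ∈ M.enabled r.1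
      · exact Or.inr ⟨M.p_nonneg _ _, M.p_sum _ _ hr⟩
      · left
        have : {x | pre (M.traj σ α x) (n + 1) = r :: h} =
            {x | pre (M.traj σ α x) n = h ∧ M.traj σ α x n = r} := by
          ext x; simp [pre, and_comm]
        rw [this]
        rcases ih h with h0 | ⟨h0, h1⟩
        · refine le_antisymm ?_ measureReal_nonneg
          rw [← h0]
          exact measureReal_mono fun x hx => hx.1
        · rw [key n h r h0 h1, stepKernel, σ.act_support _ _ _ hr, mul_zero, mul_zero]

end Run

section StepKernels

variable {Ω ι : Type*} [MeasurableSpace Ω]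

/-- `J` is a process under `μ` whose next value has conditional distribution `κ h`
given that the past values are `h`. -/
structure IsProc (μ : Measure Ω) (J : Ω → ℕ → ι) (κ : List ι → ι → ℝ) : Prop where
  meas : ∀ n h, MeasurableSet {ω | pre (J ω) n = h}
  nonneg : ∀ h i, 0 ≤ κ h i
  step : ∀ n h i, μ.real {ω | pre (J ω) n = h ∧ J ω n = i} =
    μ.real {ω | pre (J ω) n = h} * κ h i

/-- The histories all of whose steps have positive probability. -/
def Good (κ : List ι → ι → ℝ) : List ι → Prop
  | [] => True
  | i :: h => Good κ h ∧ 0 < κ h i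

/-- Consing as an embedding. -/
def consEmb (ι : Type*) : ι × List ι ↪ List ι where
  toFun r := r.1 :: r.2
  inj' _ _ h := Prod.ext (List.cons.inj h).1 (List.cons.inj h).2

/-- The lists of length `n`. -/
noncomputable def lists (ι : Type*) [Fintype ι] : ℕ → Finset (List ι)
  | 0 => {[]}
  | n + 1 => (Finset.univ ×ˢ lists ι n).map (consEmb ι)

variable [Fintype ι]

lemma pre_mem_lists (f : ℕ → ι) (n : ℕ) : pre f n ∈ lists ι n := by
  induction n with
  | zero => simp [pre, lists]
  | succ n ih =>
    rw [lists, Finset.mem_map]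
    exact ⟨(f n, pre f n), by simpa using ih, rfl⟩

lemma sum_lists_succ (n : ℕ) (F : List ι → ℝ) :
    ∑ h ∈ lists ι (n + 1), F h = ∑ h ∈ lists ι n, ∑ i, F (i :: h) := by
  rw [lists, Finset.sum_map, Finset.sum_product_right]
  rfl

lemma length_of_mem_lists {n : ℕ} {h : List ι} (hh : h ∈ lists ι n) : h.length = n := by
  induction n generalizing h with
  | zero => simpa [lists] using hh
  | succ n ih =>
    rw [lists, Finset.mem_map] at hh
    obtain ⟨r, hr, rfl⟩ := hh
    exact congrArg (· + 1) (ih (Finset.mem_product.1 hr).2)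

variable {μ : Measure Ω} [IsProbabilityMeasure μ] {J : Ω → ℕ → ι} {κ : List ι → ι → ℝ}

namespace IsProc

lemma measurable_comp_pre (hJ : IsProc μ J κ) (n : ℕ) {β : Type*} [MeasurableSpace β]
    (F : List ι → β) : Measurable fun ω => F (pre (J ω) n) := by
  let _ : MeasurableSpace (List ι) := ⊤
  exact (measurable_from_top (f := F)).comp
    (measurable_to_countable' (f := fun ω => pre (J ω) n) fun h => hJ.meas n h)

lemma integral_comp_pre (hJ : IsProc μ J κ) (n : ℕ) (F : List ι → ℝ) :
    ∫ ω, F (pre (J ω) n) ∂μ = ∑ h ∈ lists ι n, μ.real {ω | pre (J ω) n = h} * F h := by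
  classical
  have : ∀ ω, F (pre (J ω) n) =
      ∑ h ∈ lists ι n, Set.indicator {ω | pre (J ω) n = h} (fun _ => F h) ω := by
    intro ω
    rw [Finset.sum_eq_single (pre (J ω) n)]
    · simp
    · intro h _ hne
      simp [Set.indicator, Ne.symm hne]
    · intro h; exact absurd (pre_mem_lists _ _) h
  simp_rw [this]
  rw [integral_finsetSum _ fun h _ => (integrable_const _).indicator (hJ.meas n h)]
  refine Finset.sum_congr rfl fun h _ => ?_
  rw [integral_indicator_const _ (hJ.meas n h), smul_eq_mul]

lemma integrable_comp_pre (hJ : IsProc μ J κ) (n : ℕ) (F : List ι → ℝ) :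
    Integrable (fun ω => F (pre (J ω) n)) μ := by
  obtain ⟨C, hC⟩ := ((lists ι n).image (fun h => ‖F h‖)).finite_toSet.bddAbove
  refine Integrable.of_bound (hJ.measurable_comp_pre n F).aestronglyMeasurable C
    (ae_of_all _ fun ω => hC ?_)
  simp only [Finset.coe_image, Set.mem_image, SetLike.mem_coe]
  exact ⟨_, pre_mem_lists _ _, rfl⟩

lemma setOf_pre_cons (n : ℕ) (i : ι) (h : List ι) :
    {ω | pre (J ω) (n + 1) = i :: h} = {ω | pre (J ω) n = h ∧ J ω n = i} := by
  ext ω; simp [pre, and_comm]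

lemma real_cons (hJ : IsProc μ J κ) (n : ℕ) (i : ι) (h : List ι) :
    μ.real {ω | pre (J ω) (n + 1) = i :: h} = μ.real {ω | pre (J ω) n = h} * κ h i := by
  rw [setOf_pre_cons, hJ.step]

lemma good_of_ne_zero (hJ : IsProc μ J κ) {n : ℕ} {h : List ι}
    (hh : μ.real {ω | pre (J ω) n = h} ≠ 0) : Good κ h := by
  induction h generalizing n with
  | nil => trivial
  | cons i h ih =>
    cases n with
    | zero => simp [pre] at hh
    | succ n =>
      rw [hJ.real_cons] at hh
      exact ⟨ih (left_ne_zero_of_mul hh),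
        lt_of_le_of_ne (hJ.nonneg _ _) (right_ne_zero_of_mul hh).symm⟩

lemma ae_good (hJ : IsProc μ J κ) : ∀ᵐ ω ∂μ, ∀ n, Good κ (pre (J ω) n) := by
  rw [ae_all_iff]
  intro n
  have : {ω | ¬ Good κ (pre (J ω) n)} ⊆ ⋃ h ∈ {h | ¬ Good κ h}, {ω | pre (J ω) n = h} := by
    intro ω hω
    simpa using hω
  refine measure_mono_null this ((measure_biUnion_null_iff (Set.to_countable _)).2 fun h hh => ?_)
  by_contra hne
  exact hh (hJ.good_of_ne_zero (n := n) (by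
    simpa [Measure.real, ENNReal.toReal_eq_zero_iff] using hne))

lemma sum_eq_one (hJ : IsProc μ J κ) {n : ℕ} {h : List ι}
    (hh : μ.real {ω | pre (J ω) n = h} ≠ 0) : ∑ i, κ h i = 1 := by
  have h1 : ∑ i, μ.real {ω | pre (J ω) n = h ∧ J ω n = i} = μ.real {ω | pre (J ω) n = h} := by
    rw [← measureReal_biUnion_finset]
    · congr 1
      ext ω
      simp
    · intro i _ j _ hij
      refine Set.disjoint_left.2 fun ω hi hj => hij ?_
      exact hi.2.symm.trans hj.2
    · intro i _
      rw [← setOf_pre_cons]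
      exact hJ.meas _ _
  simp_rw [hJ.step, ← Finset.mul_sum] at h1
  exact mul_left_cancel₀ hh (by rw [h1, mul_one])

lemma integral_step (hJ : IsProc μ J κ) (n : ℕ) (F : List ι → ℝ) :
    ∫ ω, F (pre (J ω) (n + 1)) ∂μ = ∫ ω, ∑ i, κ (pre (J ω) n) i * F (i :: pre (J ω) n) ∂μ := by
  rw [hJ.integral_comp_pre, sum_lists_succ,
    hJ.integral_comp_pre n (fun h => ∑ i, κ h i * F (i :: h))]
  refine Finset.sum_congr rfl fun h _ => ?_
  rw [Finset.mul_sum]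
  refine Finset.sum_congr rfl fun i _ => ?_
  rw [hJ.real_cons, mul_assoc]

lemma integral_step_le (hJ : IsProc μ J κ) (n : ℕ) {F : List ι → ℝ}
    (hF : ∀ h, h.length = n → Good κ h → ∑ i, κ h i = 1 → ∑ i, κ h i * F (i :: h) ≤ F h) :
    ∫ ω, F (pre (J ω) (n + 1)) ∂μ ≤ ∫ ω, F (pre (J ω) n) ∂μ := by
  rw [hJ.integral_step, hJ.integral_comp_pre n F,
    hJ.integral_comp_pre n (fun h => ∑ i, κ h i * F (i :: h))]
  refine Finset.sum_le_sum fun h hh => ?_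
  by_cases h0 : μ.real {ω | pre (J ω) n = h} = 0
  · rw [h0, zero_mul, zero_mul]
  · exact mul_le_mul_of_nonneg_left
      (hF h (length_of_mem_lists hh) (hJ.good_of_ne_zero h0) (hJ.sum_eq_one h0)) measureReal_nonneg

end IsProc

/-- The supermartingale that multiplies by `d⁻¹` after each visit to `A` and is killed by
visits to `B`, started at time `N`. -/
noncomputable def visitWeight (A B : List ι → Prop) (d : ℝ) (N : ℕ) : List ι → ℝ
  | [] => 1
  | i :: h => open Classical in
    if h.length < N then 1 else if B (i :: h) then 0 else
      if A h then d⁻¹ * visitWeight A B d N h else visitWeight A B d N h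

lemma visitWeight_eq_one {A B : List ι → Prop} {d : ℝ} {N : ℕ} {h : List ι} (hh : h.length ≤ N) :
    visitWeight A B d N h = 1 := by
  cases h with
  | nil => rfl
  | cons i h =>
    rw [visitWeight, if_pos]
    rw [List.length_cons] at hh
    omega

lemma visitWeight_nonneg {A B : List ι → Prop} {d : ℝ} (hd : 0 ≤ d) {N : ℕ} (h : List ι) :
    0 ≤ visitWeight A B d N h := by
  induction h with
  | nil => exact zero_le_one
  | cons i h ih =>
    rw [visitWeight]
    split_ifs
    · exact zero_le_one
    · exact le_rfl
    · positivity
    · exact ih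

open Classical in
lemma IsProc.integral_visitWeight_le (hJ : IsProc μ J κ) {A B : List ι → Prop} {c : ℝ}
    (hc1 : c < 1)
    (hAB : ∀ h, Good κ h → A h → c ≤ ∑ i, if B (i :: h) then κ h i else 0) (N n : ℕ) :
    ∫ ω, visitWeight A B (1 - c) N (pre (J ω) n) ∂μ ≤ 1 := by
  have hd : 0 < 1 - c := by linarith
  induction n with
  | zero => simp [pre, visitWeight]
  | succ n ih =>
    refine (hJ.integral_step_le n fun h _ hg hsum => ?_).trans ih
    by_cases hN : h.length < N
    · simp only [visitWeight, if_pos hN, mul_one]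
      rw [visitWeight_eq_one hN.le, hsum]
    · have hm := visitWeight_nonneg (A := A) (B := B) hd.le (N := N) h
      by_cases hA : A h
      · have h1 : ∑ i, κ h i * visitWeight A B (1 - c) N (i :: h) =
            (∑ i, if B (i :: h) then 0 else κ h i) * ((1 - c)⁻¹ * visitWeight A B (1 - c) N h) := by
          rw [Finset.sum_mul]
          refine Finset.sum_congr rfl fun i _ => ?_
          simp only [visitWeight, if_neg hN, if_pos hA]
          split_ifs <;> simp
        have h2 : (∑ i, if B (i :: h) then 0 else κ h i) ≤ 1 - c := by
          have : (∑ i, if B (i :: h) then 0 else κ h i) +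
              (∑ i, if B (i :: h) then κ h i else 0) = 1 := by
            rw [← Finset.sum_add_distrib, ← hsum]
            refine Finset.sum_congr rfl fun i _ => ?_
            split_ifs <;> simp
          linarith [hAB h hg hA]
        rw [h1, ← mul_assoc]
        refine mul_le_of_le_one_left hm ?_
        rw [← div_eq_mul_inv]
        exact (div_le_one hd).2 h2
      · calc ∑ i, κ h i * visitWeight A B (1 - c) N (i :: h)
            ≤ ∑ i, κ h i * visitWeight A B (1 - c) N h := by
              refine Finset.sum_le_sum fun i _ => mul_le_mul_of_nonneg_left ?_ (hJ.nonneg _ _)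
              simp only [visitWeight, if_neg hN, if_neg hA]
              split_ifs
              · exact hm
              · exact le_rfl
          _ = visitWeight A B (1 - c) N h := by rw [← Finset.sum_mul, hsum, one_mul]

lemma tendsto_visitWeight {A B : List ι → Prop} {d : ℝ} (hd0 : 0 < d) (hd1 : d < 1) {N : ℕ}
    {f : ℕ → ι} (hA : ∃ᶠ n in atTop, A (pre f n)) (hB : ∀ n, N ≤ n → ¬ B (pre f n)) :
    Tendsto (fun n => visitWeight A B d N (pre f n)) atTop atTop := by
  classical
  have hd : 1 < d⁻¹ := (one_lt_inv₀ hd0).2 hd1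
  have hstep : ∀ n, N ≤ n → visitWeight A B d N (pre f (n + 1)) =
      if A (pre f n) then d⁻¹ * visitWeight A B d N (pre f n)
      else visitWeight A B d N (pre f n) := by
    intro n hn
    have : ¬ B (f n :: pre f n) := hB (n + 1) (by omega)
    rw [pre, visitWeight, if_neg (by simpa using hn), if_neg this]
  have hmono : ∀ n, N ≤ n → ∀ k, visitWeight A B d N (pre f n) ≤
      visitWeight A B d N (pre f (n + k)) := by
    intro n hn k
    induction k with
    | zero => exact le_rfl
    | succ k ih =>
      refine ih.trans ?_
      rw [← add_assoc, hstep _ (by omega)]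
      split_ifs
      · exact le_mul_of_one_le_left (visitWeight_nonneg hd0.le _) hd.le
      · exact le_rfl
  have hpow : ∀ k : ℕ, ∃ n, N ≤ n ∧ d⁻¹ ^ k ≤ visitWeight A B d N (pre f n) := by
    intro k
    induction k with
    | zero => exact ⟨N, le_rfl, by rw [visitWeight_eq_one (by simp), pow_zero]⟩
    | succ k ih =>
      obtain ⟨n, hn, hk⟩ := ih
      obtain ⟨m, hm, hAm⟩ := frequently_atTop.1 hA n
      refine ⟨m + 1, by omega, ?_⟩
      rw [hstep m (by omega), if_pos hAm, pow_succ']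
      obtain ⟨j, rfl⟩ := Nat.exists_eq_add_of_le hm
      exact mul_le_mul_of_nonneg_left (hk.trans (hmono n hn j)) (by positivity)
  rw [tendsto_atTop]
  intro b
  obtain ⟨k, hk⟩ := pow_unbounded_of_one_lt b hd
  obtain ⟨n, hn, hkn⟩ := hpow k
  filter_upwards [eventually_ge_atTop n] with m hm
  obtain ⟨j, rfl⟩ := Nat.exists_eq_add_of_le hm
  exact hk.le.trans (hkn.trans (hmono n hn j))

open Classical in
lemma IsProc.ae_frequently (hJ : IsProc μ J κ) {A B : List ι → Prop} {c : ℝ} (hc : 0 < c)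
    (hAB : ∀ h, Good κ h → A h → c ≤ ∑ i, if B (i :: h) then κ h i else 0) :
    ∀ᵐ ω ∂μ, (∃ᶠ n in atTop, A (pre (J ω) n)) → ∃ᶠ n in atTop, B (pre (J ω) n) := by
  wlog hc1 : c < 1 generalizing c
  · exact this (c := 1 / 2) (by norm_num)
      (fun h hg hA => le_trans (by linarith) (hAB h hg hA)) (by norm_num)
  have key : ∀ N, ∀ᵐ ω ∂μ, ¬ ((∃ᶠ n in atTop, A (pre (J ω) n)) ∧
      ∀ n, N ≤ n → ¬ B (pre (J ω) n)) := by
    intro N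
    have hmeas : ∀ n, Measurable fun ω =>
        ENNReal.ofReal (visitWeight A B (1 - c) N (pre (J ω) n)) := fun n =>
      (hJ.measurable_comp_pre n (visitWeight A B (1 - c) N)).ennreal_ofReal
    have hle : ∀ n, ∫⁻ ω, ENNReal.ofReal (visitWeight A B (1 - c) N (pre (J ω) n)) ∂μ ≤ 1 := by
      intro n
      rw [← ofReal_integral_eq_lintegral_ofReal (hJ.integrable_comp_pre n _)
        (ae_of_all _ fun ω => visitWeight_nonneg (by linarith) _)]
      exact ENNReal.ofReal_le_one.2 (hJ.integral_visitWeight_le hc1 hAB N n)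
    have hlim := (lintegral_liminf_le hmeas (μ := μ)).trans
      (liminf_le_of_frequently_le' (Eventually.of_forall hle : ∀ᶠ n in atTop, _).frequently)
    have := ae_lt_top (Measurable.liminf hmeas) (hlim.trans_lt ENNReal.one_lt_top).ne
    filter_upwards [this] with ω hω hcon
    have ht := ENNReal.tendsto_ofReal_atTop.comp
      (tendsto_visitWeight (d := 1 - c) (by linarith) (by linarith) hcon.1 hcon.2)
    exact hω.ne ht.liminf_eq
  filter_upwards [ae_all_iff.2 key] with ω hω hA hB
  obtain ⟨N, hN⟩ := eventually_atTop.1 hB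
  exact hω N ⟨hA, hN⟩

end StepKernels

section Law

variable {ι : Type*} [Fintype ι] [MeasurableSpace ι] [MeasurableSingletonClass ι]

lemma pre_eq_of_le {f f' : ℕ → ι} {n m : ℕ} (h : pre f m = pre f' m) (hn : n ≤ m) :
    pre f n = pre f' n := by
  induction hn with
  | refl => exact h
  | step _ ih => exact ih (List.cons.inj h).2

lemma measurableSet_pre_eq (n : ℕ) (h : List ι) : MeasurableSet {f : ℕ → ι | pre f n = h} := by
  induction n generalizing h with
  | zero => exact MeasurableSet.const ([] = h)
  | succ n ih =>
    cases h with
    | nil => simp [pre]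
    | cons i h =>
      have : {f : ℕ → ι | pre f (n + 1) = i :: h} = {f | f n = i} ∩ {f | pre f n = h} := by
        ext f; simp [pre]
      rw [this]
      exact (measurable_pi_apply n (measurableSet_singleton i)).inter (ih h)

lemma measure_ext_of_pre {μ ν : Measure (ℕ → ι)} [IsProbabilityMeasure μ] [IsProbabilityMeasure ν]
    (h : ∀ n l, μ.real {f | pre f n = l} = ν.real {f | pre f n = l}) : μ = ν := by
  refine ext_of_generate_finite {s | ∃ n l, s = {f : ℕ → ι | pre f n = l}} ?_ ?_ ?_ (by simp)
  · apply le_antisymm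
    · refine iSup_le fun n => ?_
      rintro _ ⟨s, -, rfl⟩
      have : (fun f : ℕ → ι => f n) ⁻¹' s =
          ⋃ r ∈ {r : ι × List ι | r.1 ∈ s}, {f | pre f (n + 1) = r.1 :: r.2} := by
        ext f
        simp only [Set.mem_preimage, Set.mem_iUnion, Set.mem_ofPred_eq, exists_prop, pre,
          List.cons.injEq]
        exact ⟨fun hf => ⟨(f n, pre f n), hf, rfl, rfl⟩, fun ⟨r, hr, h1, _⟩ => h1 ▸ hr⟩
      rw [this]
      exact MeasurableSet.biUnion (Set.to_countable _) fun r _ =>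
        MeasurableSpace.measurableSet_generateFrom ⟨_, _, rfl⟩
    · refine MeasurableSpace.generateFrom_le ?_
      rintro _ ⟨n, l, rfl⟩
      exact measurableSet_pre_eq n l
  · rintro _ ⟨n, l, rfl⟩ _ ⟨m, l', rfl⟩ ⟨f, hf, hf'⟩
    simp only [Set.mem_ofPred_eq] at hf hf'
    subst hf hf'
    rcases le_total n m with hnm | hnm
    · exact ⟨m, pre f m, Set.inter_eq_right.2 fun f' hf' => pre_eq_of_le hf' hnm⟩
    · exact ⟨n, pre f n, Set.inter_eq_left.2 fun f' hf' => pre_eq_of_le hf' hnm⟩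
  · rintro _ ⟨n, l, rfl⟩
    have := h n l
    rwa [Measure.real, Measure.real, ENNReal.toReal_eq_toReal_iff' (by simp) (by simp)] at this

end Law

end MDP

namespace OmegaWord

open Filter

lemma frequently_exists_finite {X : Type*} [Finite X] {p : X → ℕ → Prop}
    (h : ∃ᶠ n in atTop, ∃ x, p x n) : ∃ x, ∃ᶠ n in atTop, p x n := by
  by_contra hcon
  push Not at hcon
  refine h ?_
  filter_upwards [eventually_all.2 fun x => hcon x] with n hn
  push Not
  exact hn

section Merging

variable {P : Type*} [Monoid P]

/-- The product of the entries of `a` with indices in `[i, n)`. -/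
def segProd (a : ℕ → P) (i : ℕ) : ℕ → P
  | 0 => 1
  | n + 1 => if i ≤ n then segProd a i n * a n else 1

lemma segProd_succ (a : ℕ → P) {i n : ℕ} (h : i ≤ n) :
    segProd a i (n + 1) = segProd a i n * a n := if_pos h

@[simp] lemma segProd_self (a : ℕ → P) (i : ℕ) : segProd a i i = 1 := by
  cases i with
  | zero => rfl
  | succ i => exact if_neg (by omega)

lemma segProd_mul (a : ℕ → P) {i m n : ℕ} (him : i ≤ m) (hmn : m ≤ n) :
    segProd a i m * segProd a m n = segProd a i n := by
  induction n, hmn using Nat.le_induction with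
  | base => simp
  | succ n hmn ih => rw [segProd_succ a hmn, segProd_succ a (him.trans hmn), ← mul_assoc, ih]

lemma segProd_ne_one {a : ℕ → P} (ha : ∀ x n, x * a n ≠ 1) {i n : ℕ} (h : i < n) :
    segProd a i n ≠ 1 := by
  cases n with
  | zero => omega
  | succ n => rw [segProd_succ a (by omega)]; exact ha _ _

lemma segProd_eq_of_le {a : ℕ → P} {i j n m : ℕ} (hi : i ≤ n) (hj : j ≤ n) (hnm : n ≤ m)
    (h : segProd a i n = segProd a j n) : segProd a i m = segProd a j m := by
  rw [← segProd_mul a hi hnm, ← segProd_mul a hj hnm, h]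

/-- `i` is the least representative of its class at time `n`, where positions are
identified when the products from there up to `n` coincide. -/
def Alive (a : ℕ → P) (i n : ℕ) : Prop :=
  i ≤ n ∧ ∀ j < i, segProd a j n ≠ segProd a i n

variable {a : ℕ → P}

lemma Alive.anti {i n m : ℕ} (h : Alive a i m) (hi : i ≤ n) (hnm : n ≤ m) : Alive a i n :=
  ⟨hi, fun j hj he => h.2 j hj (segProd_eq_of_le (by omega) hi hnm he)⟩

lemma alive_self (ha : ∀ x n, x * a n ≠ 1) (n : ℕ) : Alive a n n :=
  ⟨le_rfl, fun j hj => by rw [segProd_self]; exact segProd_ne_one ha hj⟩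

lemma alive_zero (n : ℕ) : Alive a 0 n := ⟨Nat.zero_le _, fun j hj => by omega⟩

lemma Alive.inj {i j n : ℕ} (hi : Alive a i n) (hj : Alive a j n)
    (h : segProd a i n = segProd a j n) : i = j := by
  rcases lt_trichotomy i j with hlt | he | hlt
  · exact absurd h (hj.2 i hlt)
  · exact he
  · exact absurd h.symm (hi.2 j hlt)

lemma exists_alive {i n : ℕ} (h : i ≤ n) :
    ∃ j ≤ i, Alive a j n ∧ segProd a j n = segProd a i n := by
  classical
  have hex : ∃ j, segProd a j n = segProd a i n := ⟨i, rfl⟩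
  have hle : Nat.find hex ≤ i := Nat.find_min' hex rfl
  refine ⟨Nat.find hex, hle, ⟨hle.trans h, fun j hj he => ?_⟩, Nat.find_spec hex⟩
  exact Nat.find_min hex hj (he.trans (Nat.find_spec hex))

lemma exists_killer {i n : ℕ} (h : Alive a i n) (h' : ¬ Alive a i (n + 1)) :
    ∃ j < i, Alive a j n ∧ segProd a j (n + 1) = segProd a i (n + 1) := by
  have : ∃ j < i, segProd a j (n + 1) = segProd a i (n + 1) := by
    by_contra hcon
    push Not at hcon
    exact h' ⟨by have := h.1; omega, hcon⟩
  obtain ⟨j, hj, he⟩ := this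
  have hjn : j ≤ n := by have := h.1; omega
  obtain ⟨j', hj', ha', he'⟩ := exists_alive (a := a) hjn
  exact ⟨j', by omega, ha', by
    rw [← he]; exact segProd_eq_of_le (by omega) hjn (Nat.le_succ n) he'⟩

/-- The record of the classes at time `n`: for all alive positions `i ≤ i'`, the products
over `[i, n)`, `[i', n)`, `[0, i)` and `[i, i')`. -/
def record (a : ℕ → P) (n : ℕ) : Set (P × P × P × P) :=
  {x | ∃ i i', i ≤ i' ∧ Alive a i n ∧ Alive a i' n ∧
    x = (segProd a i n, segProd a i' n, segProd a 0 i, segProd a i i')}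

/-- The class with value `m` is merged into an earlier one when reading `c`. -/
def Killed (T : Set (P × P × P × P)) (c m : P) : Prop :=
  ∃ m' s t, (m', m, s, t) ∈ T ∧ m' ≠ m ∧ m' * c = m * c

/-- The update of the record when reading `c`. -/
def nextRecord (T : Set (P × P × P × P)) (c : P) : Set (P × P × P × P) :=
  {x | (∃ m m' s t, (m, m', s, t) ∈ T ∧ ¬ Killed T c m ∧ ¬ Killed T c m' ∧
      x = (m * c, m' * c, s, t)) ∨
    (∃ m s, (m, m, s, 1) ∈ T ∧ ¬ Killed T c m ∧ x = (m * c, 1, s, m * c)) ∨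
    ∃ m, (m, m, 1, 1) ∈ T ∧ x = (1, 1, m * c, 1)}

lemma killed_iff {i n : ℕ} (h : Alive a i n) :
    Killed (record a n) (a n) (segProd a i n) ↔ ¬ Alive a i (n + 1) := by
  constructor
  · rintro ⟨m', s, t, ⟨j, i', hji, hj, hi', he⟩, hne, hmul⟩ hal
    simp only [Prod.mk.injEq] at he
    obtain ⟨rfl, he, -, -⟩ := he
    obtain rfl := h.inj hi' he
    have hlt : j < i := lt_of_le_of_ne hji fun h => hne (by rw [h])
    refine hal.2 j hlt ?_
    rwa [segProd_succ a hj.1, segProd_succ a h.1]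
  · intro hal
    obtain ⟨j, hj, haj, he⟩ := exists_killer h hal
    refine ⟨segProd a j n, _, _, ⟨j, i, hj.le, haj, h, rfl⟩, h.2 j hj, ?_⟩
    rwa [segProd_succ a haj.1, segProd_succ a h.1] at he

lemma record_succ (ha : ∀ x n, x * a n ≠ 1) (n : ℕ) :
    record a (n + 1) = nextRecord (record a n) (a n) := by
  ext x
  constructor
  · rintro ⟨i, i', hii, hi, hi', rfl⟩
    rcases Nat.lt_or_ge n i' with h' | h'
    · obtain rfl : i' = n + 1 := le_antisymm hi'.1 h'
      rcases Nat.lt_or_ge n i with h | h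
      · obtain rfl : i = n + 1 := le_antisymm hi.1 h
        refine Or.inr (Or.inr ⟨segProd a 0 n, ⟨0, 0, le_rfl, alive_zero n, alive_zero n, ?_⟩, ?_⟩)
        · simp
        · simp [segProd_succ a (Nat.zero_le n)]
      · have hin := hi.anti h (Nat.le_succ n)
        refine Or.inr (Or.inl ⟨segProd a i n, segProd a 0 i,
          ⟨i, i, le_rfl, hin, hin, by simp⟩, ?_, ?_⟩)
        · rw [killed_iff hin, not_not]; exact hi
        · simp [segProd_succ a h]
    · have h : i ≤ n := hii.trans h'
      have hin := hi.anti h (Nat.le_succ n)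
      have hin' := hi'.anti h' (Nat.le_succ n)
      refine Or.inl ⟨_, _, _, _, ⟨i, i', hii, hin, hin', rfl⟩, ?_, ?_, ?_⟩
      · rw [killed_iff hin, not_not]; exact hi
      · rw [killed_iff hin', not_not]; exact hi'
      · simp [segProd_succ a h, segProd_succ a h']
  · rintro (⟨_, _, _, _, ⟨i, i', hii, hi, hi', he⟩, hk, hk', rfl⟩ |
      ⟨_, _, ⟨i, i', hii, hi, hi', he⟩, hk, rfl⟩ | ⟨_, ⟨i, i', hii, hi, hi', he⟩, rfl⟩)
    · simp only [Prod.mk.injEq] at he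
      obtain ⟨rfl, rfl, rfl, rfl⟩ := he
      rw [killed_iff hi, not_not] at hk
      rw [killed_iff hi', not_not] at hk'
      exact ⟨i, i', hii, hk, hk', by rw [segProd_succ a hi.1, segProd_succ a hi'.1]⟩
    · simp only [Prod.mk.injEq] at he
      obtain ⟨rfl, he, rfl, -⟩ := he
      rw [killed_iff hi, not_not] at hk
      exact ⟨i, n + 1, hk.1, hk, alive_self ha _, by
        rw [segProd_succ a hi.1, segProd_self]⟩
    · simp only [Prod.mk.injEq] at he
      obtain ⟨rfl, -, h1, -⟩ := he
      have : i = 0 := by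
        by_contra h0
        exact segProd_ne_one ha (Nat.pos_of_ne_zero h0) h1.symm
      subst this
      exact ⟨n + 1, n + 1, le_rfl, alive_self ha _, alive_self ha _, by
        rw [segProd_self, segProd_succ a hi.1]⟩

lemma record_zero : record a 0 = {(1, 1, 1, 1)} := by
  ext x
  simp only [record, Set.mem_ofPred_eq, Set.mem_singleton_iff]
  constructor
  · rintro ⟨i, i', hii, hi, hi', rfl⟩
    obtain rfl : i' = 0 := Nat.le_zero.1 hi'.1
    obtain rfl : i = 0 := Nat.le_zero.1 hii
    simp
  · rintro rfl
    exact ⟨0, 0, le_rfl, alive_zero 0, alive_zero 0, by simp⟩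

/-- The number of alive positions up to `i`. -/
noncomputable def rank (a : ℕ → P) (n i : ℕ) : ℕ := {j | j ≤ i ∧ Alive a j n}.ncard

/-- The rank of a class computed from the record. -/
noncomputable def recRank (T : Set (P × P × P × P)) (m : P) : ℕ :=
  {m' | ∃ s t, (m', m, s, t) ∈ T}.ncard

lemma finite_le_alive (n i : ℕ) : {j | j ≤ i ∧ Alive a j n}.Finite :=
  (Set.finite_Iic i).subset fun _ hj => hj.1

lemma recRank_record {i n : ℕ} (h : Alive a i n) :
    recRank (record a n) (segProd a i n) = rank a n i := by
  have : {m' | ∃ s t, (m', segProd a i n, s, t) ∈ record a n} =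
      (fun j => segProd a j n) '' {j | j ≤ i ∧ Alive a j n} := by
    ext m'
    constructor
    · rintro ⟨s, t, j, i', hji, hj, hi', he⟩
      simp only [Prod.mk.injEq] at he
      obtain ⟨rfl, he, -, -⟩ := he
      obtain rfl := h.inj hi' he
      exact ⟨j, ⟨hji, hj⟩, rfl⟩
    · rintro ⟨j, ⟨hji, hj⟩, rfl⟩
      exact ⟨_, _, j, i, hji, hj, h, rfl⟩
  rw [recRank, this, Set.InjOn.ncard_image fun j hj j' hj' he => hj.2.inj hj'.2 he]
  rfl

lemma rank_lt {i j n : ℕ} (hj : Alive a j n) (hij : i < j) : rank a n i < rank a n j := by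
  refine Set.ncard_lt_ncard ⟨fun k hk => ⟨hk.1.trans hij.le, hk.2⟩, fun hsub => ?_⟩
    (finite_le_alive n j)
  have : j ≤ i := (hsub ⟨le_rfl, hj⟩).1
  omega

/-- A class of rank at most `r` is merged into an earlier one. -/
def Kill (T : Set (P × P × P × P)) (c : P) (r : ℕ) : Prop :=
  ∃ m, Killed T c m ∧ recRank T m ≤ r

/-- A class is merged into the class of rank `r`, with the given products. -/
def Merge (T : Set (P × P × P × P)) (c : P) (r : ℕ) (s e : P) : Prop :=
  ∃ m m', (m, m', s, e) ∈ T ∧ recRank T m = r ∧ m ≠ m' ∧ m * c = m' * c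

lemma kill_iff {n r : ℕ} : Kill (record a n) (a n) r ↔
    ∃ i, Alive a i n ∧ ¬ Alive a i (n + 1) ∧ rank a n i ≤ r := by
  constructor
  · rintro ⟨m, hk, hr⟩
    obtain ⟨m', s, t, ⟨j, i, hji, hj, hi, he⟩, -⟩ := id hk
    simp only [Prod.mk.injEq] at he
    obtain ⟨-, rfl, -, -⟩ := he
    exact ⟨i, hi, (killed_iff hi).1 hk, recRank_record hi ▸ hr⟩
  · rintro ⟨i, hi, hk, hr⟩
    exact ⟨_, (killed_iff hi).2 hk, (recRank_record hi).symm ▸ hr⟩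

lemma merge_iff {n r : ℕ} {s e : P} : Merge (record a n) (a n) r s e ↔
    ∃ i i', i < i' ∧ Alive a i n ∧ Alive a i' n ∧ rank a n i = r ∧ segProd a 0 i = s ∧
      segProd a i i' = e ∧ segProd a i (n + 1) = segProd a i' (n + 1) := by
  constructor
  · rintro ⟨m, m', ⟨i, i', hii, hi, hi', he⟩, hr, hne, hmul⟩
    simp only [Prod.mk.injEq] at he
    obtain ⟨rfl, rfl, rfl, rfl⟩ := he
    refine ⟨i, i', lt_of_le_of_ne hii fun h => hne (by rw [h]), hi, hi',
      recRank_record hi ▸ hr, rfl, rfl, ?_⟩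
    rwa [segProd_succ a hi.1, segProd_succ a hi'.1]
  · rintro ⟨i, i', hii, hi, hi', hr, rfl, rfl, he⟩
    refine ⟨_, _, ⟨i, i', hii.le, hi, hi', rfl⟩, (recRank_record hi).symm ▸ hr, hi'.2 i hii, ?_⟩
    rwa [segProd_succ a hi.1, segProd_succ a hi'.1] at he

/-- The positions that stay alive forever. -/
def survivors (a : ℕ → P) : Set ℕ := {i | ∀ n, i ≤ n → Alive a i n}

lemma exists_survivors_of_lt (a : ℕ → P) (x : ℕ) :
    ∃ M, ∀ j < x, ∀ m, M ≤ m → Alive a j m → j ∈ survivors a := by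
  have : ∀ j : ℕ, ∃ M, ∀ m, M ≤ m → Alive a j m → j ∈ survivors a := by
    intro j
    by_cases hj : j ∈ survivors a
    · exact ⟨0, fun _ _ _ => hj⟩
    · have : ∃ n, j ≤ n ∧ ¬ Alive a j n := by
        by_contra hcon
        push Not at hcon
        exact hj hcon
      obtain ⟨n, hn, hna⟩ := this
      exact ⟨n, fun m hm hal => absurd (hal.anti hn hm) hna⟩
  choose M hM using this
  refine ⟨(Finset.range x).sup M, fun j hj m hm => hM j m (le_trans ?_ hm)⟩
  exact Finset.le_sup (Finset.mem_range.2 hj)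

lemma finite_survivors [Finite P] (a : ℕ → P) : (survivors a).Finite := by
  by_contra hinf
  have := Fintype.ofFinite P
  obtain ⟨F, hF, hcard⟩ := Set.Infinite.exists_subset_card_eq hinf (Fintype.card P + 1)
  have hle : F.card ≤ Fintype.card P := by
    refine Finset.card_le_card_of_injOn (t := Finset.univ) (fun i => segProd a i (F.sup id))
      (fun _ _ => Finset.mem_coe.2 (Finset.mem_univ _)) ?_
    intro i hi j hj he
    exact (hF hi _ (Finset.le_sup (f := id) hi)).inj (hF hj _ (Finset.le_sup (f := id) hj)) he
  omega

lemma exists_frequently_merge [Finite P] (ha : ∀ x n, x * a n ≠ 1) :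
    ∃ r s e, (∃ᶠ n in atTop, Merge (record a n) (a n) r s e) ∧
      ¬ ∃ᶠ n in atTop, Kill (record a n) (a n) r := by
  obtain ⟨B, hB⟩ := (finite_survivors a).bddAbove
  have hB' : ∀ i ∈ survivors a, i < B + 1 := fun i hi => Nat.lt_succ_of_le (hB hi)
  obtain ⟨M, hM⟩ := exists_survivors_of_lt a (B + 1)
  have hmerge : ∃ᶠ n in atTop, ∃ x : Fin (B + 1) × P, (x.1 : ℕ) ∈ survivors a ∧ M ≤ n ∧
      ∃ i', (x.1 : ℕ) < i' ∧ Alive a x.1 n ∧ Alive a i' n ∧ segProd a x.1 i' = x.2 ∧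
        segProd a x.1 (n + 1) = segProd a i' (n + 1) := by
    rw [frequently_atTop]
    intro n₀
    set n := max n₀ (max M (B + 1)) with hn
    have hnM : M ≤ n := by omega
    classical
    have hex : ∃ i, B + 1 ≤ i ∧ Alive a i n := ⟨n, by omega, alive_self ha n⟩
    set i' := Nat.find hex with hi'
    obtain ⟨hBi, hal⟩ := Nat.find_spec hex
    rw [← hi'] at hBi hal
    have hns : i' ∉ survivors a := fun h => by have := hB' _ h; omega
    have hdie : ∃ m, n ≤ m ∧ ¬ Alive a i' m := by
      by_contra hcon
      push Not at hcon
      refine hns fun m hm => ?_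
      rcases le_total n m with h | h
      · exact hcon m h
      · exact hal.anti hm h
    have hm1 := Nat.find_spec hdie
    have hm2 : ∀ m, m < Nat.find hdie → ¬ (n ≤ m ∧ ¬ Alive a i' m) :=
      fun m hm => Nat.find_min hdie hm
    generalize Nat.find hdie = m at hm1 hm2
    have hne : m ≠ n := fun h => hm1.2 (h ▸ hal)
    obtain ⟨m, rfl⟩ : ∃ k, m = k + 1 := ⟨m - 1, by omega⟩
    have hnm : n ≤ m := by omega
    have halm : Alive a i' m := by
      by_contra h
      exact hm2 m (Nat.lt_succ_self m) ⟨hnm, h⟩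
    obtain ⟨i, hii, hi, he⟩ := exists_killer halm hm1.2
    have hiB : i < B + 1 := by
      by_contra h
      exact Nat.find_min hex (m := i) hii
        ⟨by omega, hi.anti (by have := hal.1; omega) hnm⟩
    exact ⟨m, by omega, (⟨i, hiB⟩, segProd a i i'), hM i hiB m (by omega) hi, by omega, i', hii, hi,
      halm, rfl, he⟩
  obtain ⟨⟨i, e⟩, hie⟩ := frequently_exists_finite hmerge
  have hsurv : (i : ℕ) ∈ survivors a := by
    obtain ⟨n, hn⟩ := hie.exists
    exact hn.1
  have hrank : ∀ n, M ≤ n → (i : ℕ) ≤ n →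
      rank a n i = {j | j ≤ (i : ℕ) ∧ j ∈ survivors a}.ncard := by
    intro n hn hin
    have : {j | j ≤ (i : ℕ) ∧ Alive a j n} = {j | j ≤ (i : ℕ) ∧ j ∈ survivors a} := by
      ext j
      refine and_congr_right fun hj => ⟨fun h => hM j (by omega) n hn h, fun h => h n (by omega)⟩
    rw [rank, this]
  refine ⟨{j | j ≤ (i : ℕ) ∧ j ∈ survivors a}.ncard, segProd a 0 i, e, hie.mono ?_, ?_⟩
  · rintro n ⟨-, hn, i', hii, hi, hi', he, he'⟩
    exact merge_iff.2 ⟨i, i', hii, hi, hi', hrank n hn hi.1, rfl, he, he'⟩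
  · rw [not_frequently]
    filter_upwards [eventually_ge_atTop (max M (i : ℕ))] with n hn hk
    obtain ⟨j, hj, hj', hr⟩ := kill_iff.1 hk
    rw [← hrank n (by omega) (by omega)] at hr
    have hji : j ≤ i := by
      by_contra h
      exact absurd (rank_lt hj (not_le.1 h)) (by omega)
    exact hj' (hM j (by omega) n (by omega) hj (n + 1) (by have := hj.1; omega))

lemma exists_factorization {r : ℕ} {s e : P}
    (hm : ∃ᶠ n in atTop, Merge (record a n) (a n) r s e)
    (hk : ¬ ∃ᶠ n in atTop, Kill (record a n) (a n) r) :
    ∃ N : ℕ → ℕ, StrictMono N ∧ segProd a 0 (N 0) = s ∧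
      ∀ t, segProd a (N t) (N (t + 1)) = e := by
  obtain ⟨K, hK⟩ := eventually_atTop.1 (not_frequently.1 hk)
  obtain ⟨m₀, hm₀, hmer⟩ := frequently_atTop.1 hm K
  obtain ⟨i, -, -, hi, -, hr, hs, -, -⟩ := merge_iff.1 hmer
  have hstay : ∀ n, m₀ ≤ n → Alive a i n ∧ rank a n i = r := by
    intro n hn
    induction n, hn using Nat.le_induction with
    | base => exact ⟨hi, hr⟩
    | succ n hn ih =>
      obtain ⟨ih1, ih2⟩ := ih
      have hnk : ∀ j ≤ i, Alive a j n → Alive a j (n + 1) := by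
        intro j hj haj
        by_contra hcon
        refine hK n (by omega) (kill_iff.2 ⟨j, haj, hcon, ?_⟩)
        rw [← ih2]
        exact Set.ncard_le_ncard (fun k hk => ⟨hk.1.trans hj, hk.2⟩) (finite_le_alive n i)
      refine ⟨hnk i le_rfl ih1, ?_⟩
      rw [← ih2, rank, rank]
      congr 1
      ext j
      exact and_congr_right fun hj => ⟨fun h => h.anti (by have := ih1.1; omega) (Nat.le_succ n),
        hnk j hj⟩
  have hnext : ∀ x : ℕ, ∃ i' m, x < i' ∧ i' ≤ m ∧ segProd a i i' = e ∧
      segProd a i m = segProd a i' m := by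
    intro x
    obtain ⟨M, hM⟩ := exists_survivors_of_lt a (x + 1)
    obtain ⟨m, hmM, hmer⟩ := frequently_atTop.1 hm (max M m₀)
    obtain ⟨j, i', hji, hj, hi', hrj, -, he, he'⟩ := merge_iff.1 hmer
    obtain ⟨hi, hri⟩ := hstay m (by omega)
    obtain rfl : j = i := by
      rcases lt_trichotomy j i with h | h | h
      · have := rank_lt hi h; omega
      · exact h
      · have := rank_lt hj h; omega
    refine ⟨i', m + 1, ?_, by have := hi'.1; omega, he, he'⟩
    by_contra h
    have hs := hM i' (by omega) m (by omega) hi' (m + 1) (by have := hi'.1; omega)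
    exact hs.2 j hji he'
  choose nx tm h1 h2 h3 h4 using hnext
  let W : ℕ → {x : ℕ × ℕ // i ≤ x.1 ∧ x.1 ≤ x.2 ∧ segProd a i x.2 = segProd a x.1 x.2} :=
    fun t => Nat.rec ⟨(i, i), le_rfl, le_rfl, rfl⟩
      (fun _ x => ⟨(nx x.1.2, tm x.1.2), by have := h1 x.1.2; have := x.2; omega,
        h2 _, h4 _⟩) t
  have hW : ∀ t, (W (t + 1)).1 = (nx (W t).1.2, tm (W t).1.2) := fun t => rfl
  refine ⟨fun t => (W t).1.1, strictMono_nat_of_lt_succ fun t => ?_, hs, fun t => ?_⟩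
  · rw [hW]
    exact (W t).2.2.1.trans_lt (h1 _)
  · simp only [hW]
    have := h1 (W t).1.2
    rw [← segProd_mul a (W t).2.2.1 this.le, ← (W t).2.2.2,
      segProd_mul a ((W t).2.1.trans (W t).2.2.1) this.le, h3]

end Merging

section Buchi

variable {S : Type} (B : NBA S)

/-- One step of a Büchi automaton, recording whether an accepting state is left. -/
def edge (c : S) (x y : Fin (B.n + 1) × Bool) : Prop :=
  B.trans x.1 c y.1 ∧ (y.2 = true ↔ x.2 = true ∨ x.1 ∈ B.accept)

/-- The transformation monoid of a Büchi automaton; the second component separates letters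
from the identity. -/
abbrev TypeMonoid : Type := Function.End (Set (Fin (B.n + 1) × Bool)) × ZMod 2

instance : Finite (TypeMonoid B) :=
  inferInstanceAs
    (Finite ((Set (Fin (B.n + 1) × Bool) → Set (Fin (B.n + 1) × Bool)) × ZMod 2))

/-- The element of the transformation monoid given by a letter. -/
def letter (c : S) : TypeMonoid B := (fun Y => {x | ∃ y ∈ Y, edge B c x y}, 0)

lemma mul_letter_ne_one (x : TypeMonoid B) (c : S) : x * letter B c ≠ 1 := by
  intro h
  have h2 : x.2 * 0 = 1 := congrArg Prod.snd h
  rw [mul_zero] at h2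
  exact absurd h2 (by decide)

/-- The sequence of monoid elements of a word. -/
def letters (w : ℕ → S) (n : ℕ) : TypeMonoid B := letter B (w n)

/-- `σ` is a path of the automaton between times `i` and `n`. -/
def IsPath (w : ℕ → S) (i n : ℕ) (σ : ℕ → Fin (B.n + 1) × Bool) : Prop :=
  ∀ j, i ≤ j → j < n → edge B (w j) (σ j) (σ (j + 1))

lemma mem_segProd_iff (w : ℕ → S) {i n : ℕ} (h : i ≤ n) (Y : Set (Fin (B.n + 1) × Bool))
    (x : Fin (B.n + 1) × Bool) :
    x ∈ (segProd (letters B w) i n).1 Y ↔ ∃ σ, IsPath B w i n σ ∧ σ i = x ∧ σ n ∈ Y := by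
  classical
  induction n, h using Nat.le_induction generalizing Y with
  | base =>
    rw [segProd_self]
    constructor
    · intro hx
      exact ⟨fun _ => x, fun j hj hj' => by omega, rfl, hx⟩
    · rintro ⟨σ, -, rfl, hY⟩
      exact hY
  | succ n hin ih =>
    rw [segProd_succ _ hin]
    have : ((segProd (letters B w) i n * letters B w n).1) Y =
        (segProd (letters B w) i n).1 ({x | ∃ y ∈ Y, edge B (w n) x y}) := rfl
    rw [this, ih]
    constructor
    · rintro ⟨σ, hσ, rfl, y, hy, he⟩
      refine ⟨Function.update σ (n + 1) y, fun j hj hj' => ?_, ?_, ?_⟩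
      · rw [Function.update_of_ne (by omega : j ≠ n + 1)]
        rcases Nat.lt_succ_iff_lt_or_eq.1 hj' with h | rfl
        · rw [Function.update_of_ne (by omega)]
          exact hσ j hj h
        · rw [Function.update_self]; exact he
      · rw [Function.update_of_ne (by omega)]
      · rw [Function.update_self]; exact hy
    · rintro ⟨σ, hσ, hx, hy⟩
      exact ⟨σ, fun j hj hj' => hσ j hj (by omega), hx, σ (n + 1), hy, hσ n hin (by omega)⟩

lemma IsPath.flag {w : ℕ → S} {i n : ℕ} (h : i ≤ n) {σ : ℕ → Fin (B.n + 1) × Bool}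
    (hσ : IsPath B w i n σ) (h0 : (σ i).2 = false) (h1 : (σ n).2 = true) :
    ∃ j, i ≤ j ∧ j < n ∧ (σ j).1 ∈ B.accept := by
  induction n, h using Nat.le_induction with
  | base => rw [h0] at h1; cases h1
  | succ n hin ih =>
    rcases (hσ n hin (by omega)).2.1 h1 with h | h
    · obtain ⟨j, hj, hj', hacc⟩ := ih (fun j hj hj' => hσ j hj (by omega)) h
      exact ⟨j, hj, by omega, hacc⟩
    · exact ⟨n, hin, by omega, h⟩

lemma mem_lang_of_segProd_eq {w w' : ℕ → S} {N N' : ℕ → ℕ} (hN : StrictMono N)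
    (hN' : StrictMono N') (hN0 : N 0 = 0) (hN0' : N' 0 = 0)
    (heq : ∀ t, segProd (letters B w) (N t) (N (t + 1)) =
      segProd (letters B w') (N' t) (N' (t + 1)))
    (hw : w ∈ B.lang) : w' ∈ B.lang := by
  classical
  obtain ⟨ρ, hstart, htrans, hacc⟩ := hw
  have hlt := fun t => hN (Nat.lt_succ_self t)
  have hlt' := fun t => hN' (Nat.lt_succ_self t)
  have hpath : ∀ t, ∃ σ, IsPath B w' (N' t) (N' (t + 1)) σ ∧ σ (N' t) = (ρ (N t), false) ∧
      σ (N' (t + 1)) = (ρ (N (t + 1)),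
        decide (∃ i, N t ≤ i ∧ i < N (t + 1) ∧ ρ i ∈ B.accept)) := by
    intro t
    have h1 : (ρ (N t), false) ∈ (segProd (letters B w) (N t) (N (t + 1))).1
        {(ρ (N (t + 1)), decide (∃ i, N t ≤ i ∧ i < N (t + 1) ∧ ρ i ∈ B.accept))} := by
      rw [mem_segProd_iff B w (hlt t).le]
      refine ⟨fun j => (ρ j, decide (∃ i, N t ≤ i ∧ i < j ∧ ρ i ∈ B.accept)), ?_, ?_, rfl⟩
      · intro j hj hj'
        refine ⟨htrans j, ?_⟩
        simp only [decide_eq_true_eq]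
        constructor
        · rintro ⟨i, hi, hij, ha⟩
          rcases Nat.lt_succ_iff_lt_or_eq.1 hij with h | rfl
          · exact Or.inl ⟨i, hi, h, ha⟩
          · exact Or.inr ha
        · rintro (⟨i, hi, hij, ha⟩ | ha)
          · exact ⟨i, hi, by omega, ha⟩
          · exact ⟨j, hj, by omega, ha⟩
      · simp only [Prod.mk.injEq, true_and, decide_eq_false_iff_not]
        rintro ⟨i, hi, hi', -⟩
        omega
    rw [heq, mem_segProd_iff B w' (hlt' t).le] at h1
    exact h1
  choose σ hσ hσ0 hσ1 using hpath
  have hseg : ∀ j, ∃ t, N' t ≤ j ∧ j < N' (t + 1) := by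
    intro j
    have hex : ∃ t, j < N' (t + 1) := ⟨j, hN'.id_le (j + 1)⟩
    refine ⟨Nat.find hex, ?_, Nat.find_spec hex⟩
    rcases Nat.eq_zero_or_pos (Nat.find hex) with h | h
    · rw [h, hN0']; exact Nat.zero_le _
    · have := Nat.find_min hex (m := Nat.find hex - 1) (by omega)
      rw [Nat.sub_add_cancel h] at this
      exact not_lt.1 this
  choose seg hs hs' using hseg
  have huniq : ∀ t j, N' t ≤ j → j < N' (t + 1) → seg j = t := by
    intro t j h1 h2
    have h3 := hN'.lt_iff_lt.1 (h1.trans_lt (hs' j))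
    have h4 := hN'.lt_iff_lt.1 ((hs j).trans_lt h2)
    omega
  set ρ' : ℕ → Fin (B.n + 1) := fun j => (σ (seg j) j).1 with hρ'
  have hval : ∀ t j, N' t ≤ j → j ≤ N' (t + 1) → ρ' j = (σ t j).1 := by
    intro t j h1 h2
    rcases h2.lt_or_eq with h | h
    · simp only [hρ', huniq t j h1 h]
    · have : seg j = t + 1 := huniq (t + 1) j h.ge (h ▸ hlt' (t + 1))
      simp only [hρ', this]
      rw [h, hσ0, hσ1]
  refine ⟨ρ', ?_, fun j => ?_, fun K => ?_⟩
  · rw [hval 0 0 hN0'.le (Nat.zero_le _)]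
    have := hσ0 0
    rw [hN0'] at this
    rw [this, hN0]; exact hstart
  · rw [hval (seg j) j (hs j) (hs' j).le,
      hval (seg j) (j + 1) ((hs j).trans (Nat.le_succ j)) (hs' j)]
    exact (hσ (seg j) j (hs j) (hs' j)).1
  · obtain ⟨m, hm, ham⟩ := hacc (N K)
    have hseg : ∃ t, N t ≤ m ∧ m < N (t + 1) := by
      have hex : ∃ t, m < N (t + 1) := ⟨m, hN.id_le (m + 1)⟩
      refine ⟨Nat.find hex, ?_, Nat.find_spec hex⟩
      rcases Nat.eq_zero_or_pos (Nat.find hex) with h | h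
      · rw [h, hN0]; exact Nat.zero_le _
      · have := Nat.find_min hex (m := Nat.find hex - 1) (by omega)
        rw [Nat.sub_add_cancel h] at this
        exact not_lt.1 this
    obtain ⟨t, ht, ht'⟩ := hseg
    have hKt : K ≤ t := by
      have := hN.lt_iff_lt.1 (hm.trans_lt ht')
      omega
    obtain ⟨j, hj, hj', haj⟩ := IsPath.flag B (hlt' t).le (hσ t) (by rw [hσ0])
      (by rw [hσ1]; simpa using ⟨m, ht, ht', ham⟩)
    exact ⟨j, hKt.trans ((hN'.id_le t).trans hj), by rw [hval t j hj hj'.le]; exact haj⟩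

lemma mem_lang_of_factorization {w w' : ℕ → S} {N N' : ℕ → ℕ} (hN : StrictMono N)
    (hN' : StrictMono N') {s e : TypeMonoid B}
    (hs : segProd (letters B w) 0 (N 0) = s) (hs' : segProd (letters B w') 0 (N' 0) = s)
    (he : ∀ t, segProd (letters B w) (N t) (N (t + 1)) = e)
    (he' : ∀ t, segProd (letters B w') (N' t) (N' (t + 1)) = e)
    (hw : w ∈ B.lang) : w' ∈ B.lang := by
  have key : ∀ N : ℕ → ℕ, StrictMono N → StrictMono fun t => if t = 0 then 0 else N t := by
    intro N hN
    refine strictMono_nat_of_lt_succ fun t => ?_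
    by_cases ht : t = 0
    · simp only [ht, if_pos, zero_add, if_neg one_ne_zero]
      exact (Nat.zero_le _).trans_lt (hN zero_lt_one)
    · simp only [ht, if_false, Nat.succ_ne_zero]
      exact hN (Nat.lt_succ_self t)
  have hseg : ∀ (w : ℕ → S) (N : ℕ → ℕ), StrictMono N → segProd (letters B w) 0 (N 0) = s →
      (∀ t, segProd (letters B w) (N t) (N (t + 1)) = e) → ∀ t : ℕ,
      segProd (letters B w) (if t = 0 then 0 else N t) (if t + 1 = 0 then 0 else N (t + 1)) =
        if t = 0 then s * e else e := by
    intro w N hN hs he t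
    by_cases ht : t = 0
    · simp only [ht, if_pos, zero_add, if_neg one_ne_zero]
      rw [← hs, ← he 0, segProd_mul _ (Nat.zero_le _) (hN.monotone (Nat.zero_le _))]
    · simp only [ht, if_false, Nat.succ_ne_zero, he]
  exact mem_lang_of_segProd_eq B (key N hN) (key N' hN') rfl rfl
    (fun t => (hseg w N hN hs he t).trans (hseg w' N' hN' hs' he' t).symm) hw

/-- The pairs of monoid elements realised by a factorization of an accepted word. -/
def Linked (s e : TypeMonoid B) : Prop :=
  ∃ w ∈ B.lang, ∃ N : ℕ → ℕ, StrictMono N ∧ segProd (letters B w) 0 (N 0) = s ∧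
    ∀ t, segProd (letters B w) (N t) (N (t + 1)) = e

lemma mem_lang_iff (w : ℕ → S) :
    w ∈ B.lang ↔ ∃ r s e, Linked B s e ∧
      (∃ᶠ n in atTop, Merge (record (letters B w) n) (letters B w n) r s e) ∧
      ¬ ∃ᶠ n in atTop, Kill (record (letters B w) n) (letters B w n) r := by
  constructor
  · intro hw
    obtain ⟨r, s, e, hm, hk⟩ := exists_frequently_merge (a := letters B w)
      fun x n => mul_letter_ne_one B x (w n)
    obtain ⟨N, hN, hs, he⟩ := exists_factorization hm hk
    exact ⟨r, s, e, ⟨w, hw, N, hN, hs, he⟩, hm, hk⟩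
  · rintro ⟨r, s, e, ⟨w', hw', N', hN', hs', he'⟩, hm, hk⟩
    obtain ⟨N, hN, hs, he⟩ := exists_factorization hm hk
    exact mem_lang_of_factorization B hN' hN hs' hs he' he hw'

end Buchi

section Muller

/-- The run of a deterministic automaton on a word. -/
def detRun {S Q : Type*} (q₀ : Q) (step : Q → S → Q) (w : ℕ → S) : ℕ → Q
  | 0 => q₀
  | n + 1 => step (detRun q₀ step w n) (w n)

/-- The values taken infinitely often. -/
def infSet {X : Type*} (f : ℕ → X) : Set X := {x | ∃ᶠ n in atTop, f n = x}

lemma frequently_iff_infSet {X : Type*} [Finite X] (f : ℕ → X) (p : X → Prop) :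
    (∃ᶠ n in atTop, p (f n)) ↔ ∃ x ∈ infSet f, p x := by
  constructor
  · intro h
    have : ∃ᶠ n in atTop, ∃ x, f n = x ∧ p x := h.mono fun n hn => ⟨_, rfl, hn⟩
    obtain ⟨x, hx⟩ := frequently_exists_finite this
    exact ⟨x, hx.mono fun n hn => hn.1, hx.exists.choose_spec.2⟩
  · rintro ⟨x, hx, hp⟩
    exact hx.mono fun n hn => hn ▸ hp

lemma infSet_comp {X Y : Type*} [Finite X] (f : ℕ → X) (g : X → Y) :
    infSet (fun n => g (f n)) = g '' infSet f := by
  ext y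
  rw [infSet, Set.mem_ofPred_eq, frequently_iff_infSet f fun x => g x = y]
  rfl

lemma frequently_add_one {p : ℕ → Prop} :
    (∃ᶠ n in atTop, p (n + 1)) ↔ ∃ᶠ n in atTop, p n := by
  have := frequently_map (f := atTop) (m := fun n : ℕ => n + 1) (P := p)
  rw [map_add_atTop_eq_nat] at this
  exact this.symm

theorem exists_muller {S : Type} [Fintype S] {L : Set (ℕ → S)} (hL : IsOmegaRegular L) :
    ∃ (Q : Type) (_ : Fintype Q) (q₀ : Q) (step : Q → S → Q) (acc : Set Q → Prop),
      ∀ w, w ∈ L ↔ acc (infSet (detRun q₀ step w)) := by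
  obtain ⟨B, rfl⟩ := hL
  let R : Type := Set (TypeMonoid B × TypeMonoid B × TypeMonoid B × TypeMonoid B)
  have : Finite R := inferInstanceAs
    (Finite (Set (TypeMonoid B × TypeMonoid B × TypeMonoid B × TypeMonoid B)))
  let step : R × Option (R × S) → S → R × Option (R × S) :=
    fun q c => (nextRecord q.1 (letter B c), some (q.1, c))
  let q₀ : R × Option (R × S) := (({(1, 1, 1, 1)} : Set _), none)
  have hrun : ∀ w n, (detRun q₀ step w n).1 = record (letters B w) n := by
    intro w n
    induction n with
    | zero => exact record_zero.symm
    | succ n ih =>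
      rw [record_succ (a := letters B w) fun x n => mul_letter_ne_one B x (w n), ← ih]
      rfl
  have hrun' : ∀ w n, (detRun q₀ step w (n + 1)).2 = some (record (letters B w) n, w n) := by
    intro w n
    rw [← hrun]
    rfl
  have hfreq : ∀ w (p : R → S → Prop), (∃ᶠ n in atTop, p (record (letters B w) n) (w n)) ↔
      ∃ x ∈ infSet (detRun q₀ step w), ∃ y, x.2 = some y ∧ p y.1 y.2 := by
    intro w p
    rw [← frequently_iff_infSet (detRun q₀ step w) fun x => ∃ y, x.2 = some y ∧ p y.1 y.2,
      ← frequently_add_one (p := fun n => ∃ y, (detRun q₀ step w n).2 = some y ∧ p y.1 y.2)]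
    simp only [hrun', Option.some.injEq, exists_eq_left']
  refine ⟨R × Option (R × S), Fintype.ofFinite _, q₀, step, fun X => ∃ r s e, Linked B s e ∧
    (∃ x ∈ X, ∃ y, x.2 = some y ∧ Merge y.1 (letter B y.2) r s e) ∧
    ¬ ∃ x ∈ X, ∃ y, x.2 = some y ∧ Kill y.1 (letter B y.2) r, fun w => ?_⟩
  rw [mem_lang_iff]
  refine exists_congr fun r => exists_congr fun s => exists_congr fun e => ?_
  rw [← hfreq w (fun T c => Merge T (letter B c) r s e),
    ← hfreq w (fun T c => Kill T (letter B c) r)]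
  rfl

/-- Finitely many ω-regular languages are recognised by a common deterministic automaton
through the set of states visited infinitely often. -/
theorem exists_muller_family {S : Type} [Fintype S] {k : ℕ} {L : Fin k → Set (ℕ → S)}
    (hL : ∀ i, IsOmegaRegular (L i)) :
    ∃ (Q : Type) (_ : Fintype Q) (q₀ : Q) (step : Q → S → Q) (acc : Fin k → Set Q → Prop),
      ∀ i w, w ∈ L i ↔ acc i (infSet (detRun q₀ step w)) := by
  classical
  choose Q hQ q₀ step acc hacc using fun i => exists_muller (hL i)
  let step' : (∀ i, Q i) → S → ∀ i, Q i := fun q c i => step i (q i) c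
  have hrun : ∀ w i n, detRun q₀ step' w n i = detRun (q₀ i) (step i) w n := by
    intro w i n
    induction n with
    | zero => rfl
    | succ n ih => simp only [detRun, step', ih]
  refine ⟨∀ i, Q i, inferInstance, q₀, step', fun i X => acc i ((fun q => q i) '' X),
    fun i w => ?_⟩
  have : (fun n => detRun q₀ step' w n i) = detRun (q₀ i) (step i) w := funext (hrun w i)
  rw [hacc, ← this, infSet_comp (detRun q₀ step' w) fun q => q i]

end Muller

end OmegaWord

namespace MDP

open MeasureTheory ProbabilityTheory Filter OmegaWord

set_option linter.unusedSectionVars false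

section EndComponents

variable {V A : Type} [Fintype V] [Fintype A]

/-- One step inside a set of state-action pairs. -/
def PairStep (M : MDP V A) (E : Set (V × A)) (e e' : V × A) : Prop :=
  e ∈ E ∧ e' ∈ E ∧ 0 < M.p e.1 e.2 e'.1

/-- A set of state-action pairs is an end component if it is closed under the transitions
and strongly connected. -/
structure IsEC (M : MDP V A) (E : Set (V × A)) : Prop where
  nonempty : E.Nonempty
  enabled : ∀ e ∈ E, e.2 ∈ M.enabled e.1
  closed : ∀ e ∈ E, ∀ v, 0 < M.p e.1 e.2 v → ∃ a, (v, a) ∈ E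
  connected : ∀ e₁ ∈ E, ∀ e₂ ∈ E, Relation.TransGen (PairStep M E) e₁ e₂

variable (M : MDP V A)

lemma exists_succ {v : V} {a : A} (ha : a ∈ M.enabled v) : ∃ v', 0 < M.p v a v' := by
  by_contra hcon
  push Not at hcon
  have : ∑ v', M.p v a v' ≤ 0 := Finset.sum_nonpos fun v' _ => hcon v'
  rw [M.p_sum v a ha] at this
  linarith

lemma exists_isEC_of_closed {Y : Set V} (hY : Y.Nonempty)
    (hcl : ∀ v ∈ Y, ∀ a ∈ M.enabled v, ∀ v', 0 < M.p v a v' → v' ∈ Y) :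
    ∃ E, IsEC M E ∧ ∀ e ∈ E, e.1 ∈ Y := by
  let F : Set (Set V) := {Y' | Y' ⊆ Y ∧ Y'.Nonempty ∧
    ∀ v ∈ Y', ∀ a ∈ M.enabled v, ∀ v', 0 < M.p v a v' → v' ∈ Y'}
  obtain ⟨Y₀, ⟨hsub, hne, hcl₀⟩, hmin⟩ :=
    Set.exists_min_image F Set.ncard (Set.toFinite _) ⟨Y, le_rfl, hY, hcl⟩
  refine ⟨{e | e.1 ∈ Y₀ ∧ e.2 ∈ M.enabled e.1}, ⟨?_, fun e he => he.2, ?_, ?_⟩,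
    fun e he => hsub he.1⟩
  · obtain ⟨v, hv⟩ := hne
    obtain ⟨a, ha⟩ := M.enabled_nonempty v
    exact ⟨(v, a), hv, ha⟩
  · intro e he v hv
    obtain ⟨a, ha⟩ := M.enabled_nonempty v
    exact ⟨a, hcl₀ _ he.1 _ he.2 _ hv, ha⟩
  · intro e₁ he₁ e₂ he₂
    set E : Set (V × A) := {e | e.1 ∈ Y₀ ∧ e.2 ∈ M.enabled e.1} with hE
    let C : Set V := {v | v ∈ Y₀ ∧ ∀ a ∈ M.enabled v, Relation.TransGen (PairStep M E) e₁ (v, a)}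
    have hC : C = Y₀ := by
      have hCsub : C ⊆ Y₀ := fun v hv => hv.1
      refine Set.eq_of_subset_of_ncard_le hCsub (hmin C ⟨hCsub.trans hsub, ?_, ?_⟩)
      · obtain ⟨v, hv⟩ := exists_succ M he₁.2
        have hvY := hcl₀ _ he₁.1 _ he₁.2 v hv
        exact ⟨v, hvY, fun a ha => Relation.TransGen.single ⟨he₁, ⟨hvY, ha⟩, hv⟩⟩
      · intro v hv a ha v' hv'
        have hvY := hcl₀ _ hv.1 _ ha v' hv'
        exact ⟨hvY, fun a' ha' => (hv.2 a ha).tail ⟨⟨hv.1, ha⟩, ⟨hvY, ha'⟩, hv'⟩⟩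
    exact (hC.symm ▸ he₂.1 : e₂.1 ∈ C).2 e₂.2 he₂.2

/-- The expected value of `x` after playing `a` in `v`. -/
def expect (x : V → ℝ) (v : V) (a : A) : ℝ := ∑ v', M.p v a v' * x v'

/-- Excessive functions dominating the reward `g` on every end component. -/
def Feasible (g : Set (V × A) → ℝ) (x : V → ℝ) : Prop :=
  (∀ v, ∀ a ∈ M.enabled v, M.expect x v a ≤ x v) ∧
    ∀ E, IsEC M E → ∀ e ∈ E, g E ≤ x e.1

variable {M}

lemma eq_of_expect_le {x : V → ℝ} {v : V} {a : A} (ha : a ∈ M.enabled v) {c : ℝ}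
    (hx : ∀ v', 0 < M.p v a v' → c ≤ x v') (hle : M.expect x v a ≤ c) {v' : V}
    (hv' : 0 < M.p v a v') : x v' = c := by
  have hnn : ∀ w ∈ Finset.univ, 0 ≤ M.p v a w * (x w - c) := by
    intro w _
    rcases (M.p_nonneg v a w).eq_or_lt with h | h
    · rw [← h, zero_mul]
    · exact mul_nonneg h.le (sub_nonneg.2 (hx w h))
  have hsum : ∑ w, M.p v a w * (x w - c) = M.expect x v a - c := by
    simp only [expect, mul_sub, Finset.sum_sub_distrib, ← Finset.sum_mul, M.p_sum v a ha, one_mul]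
  have h0 : ∑ w, M.p v a w * (x w - c) = 0 :=
    le_antisymm (by rw [hsum]; linarith) (Finset.sum_nonneg hnn)
  have := (Finset.sum_eq_zero_iff_of_nonneg hnn).1 h0 v' (Finset.mem_univ _)
  rcases mul_eq_zero.1 this with h | h
  · exact absurd h hv'.ne'
  · linarith

lemma Feasible.exists_le [Nonempty V] {g : Set (V × A) → ℝ} {x : V → ℝ} (hx : Feasible M g x) :
    ∃ E, ∀ v, g E ≤ x v := by
  obtain ⟨v₀, hv₀⟩ := Finite.exists_min x
  obtain ⟨E, hE, hsub⟩ := exists_isEC_of_closed M (Y := {v | x v = x v₀}) ⟨v₀, rfl⟩ (by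
    intro v hv a ha v' hv'
    exact eq_of_expect_le ha (fun w _ => hv₀ w) ((hx.1 v a ha).trans hv.le) hv')
  obtain ⟨e, he⟩ := hE.nonempty
  exact ⟨E, fun v => (hx.2 E hE e he).trans ((hsub e he).le.trans (hv₀ v))⟩

lemma exists_minimal_feasible [Nonempty V] (g : Set (V × A) → ℝ) :
    ∃ x, Feasible M g x ∧ ∀ y, Feasible M g y → ∀ v, x v ≤ y v := by
  obtain ⟨Em, hEm⟩ := Finite.exists_max g
  obtain ⟨El, hEl⟩ := Finite.exists_min g
  have hconst : Feasible M g fun _ => g Em := by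
    refine ⟨fun v a ha => ?_, fun E _ e _ => hEm E⟩
    rw [expect, ← Finset.sum_mul, M.p_sum v a ha, one_mul]
  have : Nonempty {y : V → ℝ // Feasible M g y} := ⟨⟨_, hconst⟩⟩
  have hbdd : ∀ v, BddBelow (Set.range fun y : {y : V → ℝ // Feasible M g y} => y.1 v) := by
    intro v
    refine ⟨g El, ?_⟩
    rintro _ ⟨y, rfl⟩
    obtain ⟨E, hE⟩ := y.2.exists_le
    exact (hEl E).trans (hE v)
  have hle : ∀ y, Feasible M g y → ∀ v,
      (⨅ y : {y : V → ℝ // Feasible M g y}, y.1 v) ≤ y v :=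
    fun y hy v => ciInf_le (hbdd v) ⟨y, hy⟩
  refine ⟨fun v => ⨅ y : {y : V → ℝ // Feasible M g y}, y.1 v, ⟨fun v a ha => ?_, ?_⟩, hle⟩
  · refine le_ciInf fun y => le_trans ?_ (y.2.1 v a ha)
    exact Finset.sum_le_sum fun v' _ =>
      mul_le_mul_of_nonneg_left (hle y.1 y.2 v') (M.p_nonneg _ _ _)
  · exact fun E hE e he => le_ciInf fun y => y.2.2 E hE e he

lemma exists_pos_le_of_pos {ι : Type*} [Finite ι] (f : ι → ℝ) :
    ∃ ε > 0, ∀ i, 0 < f i → ε ≤ f i := by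
  have : ∀ᶠ ε in nhdsWithin (0 : ℝ) (Set.Ioi 0), ∀ i, 0 < f i → ε ≤ f i := by
    refine eventually_all.2 fun i => ?_
    by_cases hi : 0 < f i
    · filter_upwards [(eventually_lt_nhds hi).filter_mono nhdsWithin_le_nhds] with ε hε _
      exact hε.le
    · exact Eventually.of_forall fun ε h => absurd h hi
  obtain ⟨ε, h1, h2⟩ := (this.and self_mem_nhdsWithin).exists
  exact ⟨ε, h2, h1⟩

lemma IsEC.const_of_eq {g : Set (V × A) → ℝ} {x : V → ℝ} (hx : Feasible M g x)
    {E : Set (V × A)} (hE : IsEC M E) {e : V × A} (he : e ∈ E) (hge : g E = x e.1) :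
    ∀ e' ∈ E, x e'.1 = g E := by
  intro e' he'
  have hstep : ∀ e₁ e₂, PairStep M E e₁ e₂ → x e₁.1 = g E → x e₂.1 = g E := by
    rintro e₁ e₂ ⟨h1, h2, hp⟩ hx1
    refine eq_of_expect_le (hE.enabled _ h1) ?_ ((hx.1 _ _ (hE.enabled _ h1)).trans hx1.le) hp
    intro v' hv'
    obtain ⟨a', ha'⟩ := hE.closed _ h1 _ hv'
    exact hx.2 E hE _ ha'
  have := hE.connected e he e' he'
  induction this with
  | single h => exact hstep _ _ h hge.symm
  | tail _ h ih => exact hstep _ _ h (ih h.1)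

/-- The end components on which `x` is constantly equal to their reward. -/
def Tight (M : MDP V A) (g : Set (V × A) → ℝ) (x : V → ℝ) (E : Set (V × A)) : Prop :=
  IsEC M E ∧ ∀ e ∈ E, x e.1 = g E

/-- A step by an optimal action. -/
def OptStep (M : MDP V A) (x : V → ℝ) (v v' : V) : Prop :=
  ∃ a ∈ M.enabled v, M.expect x v a = x v ∧ 0 < M.p v a v'

lemma reach_tight {g : Set (V × A) → ℝ} {x : V → ℝ} (hx : Feasible M g x)
    (hmin : ∀ y, Feasible M g y → ∀ v, x v ≤ y v) (v : V) :
    ∃ v', Relation.ReflTransGen (OptStep M x) v v' ∧ ∃ E, Tight M g x E ∧ ∃ a, (v', a) ∈ E := by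
  classical
  by_contra hcon
  set X : Set V := {v | ¬ ∃ v', Relation.ReflTransGen (OptStep M x) v v' ∧
    ∃ E, Tight M g x E ∧ ∃ a, (v', a) ∈ E} with hX
  have hv : v ∈ X := hcon
  obtain ⟨ε₁, hε₁, h₁⟩ := exists_pos_le_of_pos fun e : V × A => x e.1 - M.expect x e.1 e.2
  obtain ⟨ε₂, hε₂, h₂⟩ := exists_pos_le_of_pos fun e : Set (V × A) × V => x e.2 - g e.1
  set ε := min ε₁ ε₂ with hε
  have hεpos : 0 < ε := lt_min hε₁ hε₂
  let y : V → ℝ := fun w => if w ∈ X then x w - ε else x w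
  have hyx : ∀ w, y w ≤ x w := by
    intro w
    simp only [y]
    split_ifs <;> linarith
  have hyle : ∀ w a, M.expect y w a ≤ M.expect x w a := fun w a =>
    Finset.sum_le_sum fun w' _ => mul_le_mul_of_nonneg_left (hyx w') (M.p_nonneg _ _ _)
  have hy : Feasible M g y := by
    refine ⟨fun w a ha => ?_, fun E hE e he => ?_⟩
    · by_cases hw : w ∈ X
      · have hyw : y w = x w - ε := if_pos hw
        rw [hyw]
        rcases (hx.1 w a ha).lt_or_eq with hlt | heq
        · have h3 := h₁ (w, a) (sub_pos.2 hlt)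
          have h4 := min_le_left ε₁ ε₂
          simp only at h3
          linarith [hyle w a]
        · have hsucc : ∀ w', 0 < M.p w a w' → w' ∈ X := by
            rintro w' hw' ⟨v', hr, h⟩
            exact hw ⟨v', hr.head ⟨a, ha, heq, hw'⟩, h⟩
          refine le_of_eq ?_
          calc M.expect y w a = ∑ w', M.p w a w' * (x w' - ε) := by
                refine Finset.sum_congr rfl fun w' _ => ?_
                rcases (M.p_nonneg w a w').eq_or_lt with h | h
                · rw [← h, zero_mul, zero_mul]
                · rw [show y w' = x w' - ε from if_pos (hsucc w' h)]
            _ = x w - ε := by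
                simp only [mul_sub, Finset.sum_sub_distrib, ← Finset.sum_mul, M.p_sum w a ha,
                  one_mul]
                rw [← heq]; rfl
      · rw [show y w = x w from if_neg hw]
        exact (hyle w a).trans (hx.1 w a ha)
    · by_cases hw : e.1 ∈ X
      · rw [show y e.1 = x e.1 - ε from if_pos hw]
        rcases (hx.2 E hE e he).lt_or_eq with hlt | heq
        · have h3 := h₂ (E, e.1) (sub_pos.2 hlt)
          have h4 := min_le_right ε₁ ε₂
          simp only at h3
          linarith
        · exact absurd ⟨e.1, Relation.ReflTransGen.refl, E,
            ⟨hE, hE.const_of_eq hx he heq⟩, e.2, he⟩ hw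
      · rw [show y e.1 = x e.1 from if_neg hw]
        exact hx.2 E hE e he
  have := hmin y hy v
  rw [show y v = x v - ε from if_pos hv] at this
  linarith

/-- For every reward on end components there is an excessive function dominating it and a
memoryless set of actions conserving it whose end components are tight. -/
theorem exists_value_and_selector [Nonempty V] (M : MDP V A) (g : Set (V × A) → ℝ) :
    ∃ (x : V → ℝ) (d : V → Finset A), Feasible M g x ∧
      (∀ v, (d v).Nonempty ∧ d v ⊆ M.enabled v) ∧
      (∀ v, ∀ a ∈ d v, M.expect x v a = x v) ∧
      ∀ R, IsEC M R → (∀ e ∈ R, e.2 ∈ d e.1 ∧ ∀ a ∈ d e.1, (e.1, a) ∈ R) →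
        ∀ e ∈ R, x e.1 = g R := by
  classical
  obtain ⟨x, hx, hmin⟩ := exists_minimal_feasible (M := M) g
  have hreach := reach_tight hx hmin
  obtain ⟨rk, hrk⟩ := exists_injective_nat (Set (V × A))
  have hfirst : ∀ v, ∃ E : Set (V × A), (∃ E', Tight M g x E' ∧ ∃ a, (v, a) ∈ E') →
      (Tight M g x E ∧ ∃ a, (v, a) ∈ E) ∧
      ∀ E', Tight M g x E' → (∃ a, (v, a) ∈ E') → rk E ≤ rk E' := by
    intro v
    by_cases h : ∃ E', Tight M g x E' ∧ ∃ a, (v, a) ∈ E'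
    · obtain ⟨E, hE, hE'⟩ := Set.exists_min_image {E' | Tight M g x E' ∧ ∃ a, (v, a) ∈ E'} rk
        (Set.toFinite _) h
      exact ⟨E, fun _ => ⟨hE, fun E' h1 h2 => hE' E' ⟨h1, h2⟩⟩⟩
    · exact ⟨∅, fun h' => absurd h' h⟩
  choose first hfirst using hfirst
  let d : V → Finset A := fun v =>
    if ∃ E', Tight M g x E' ∧ ∃ a, (v, a) ∈ E' then
      Finset.univ.filter fun a => (v, a) ∈ first v
    else (M.enabled v).filter fun a => M.expect x v a = x v
  have hd1 : ∀ v, (∃ E', Tight M g x E' ∧ ∃ a, (v, a) ∈ E') → ∀ a, a ∈ d v ↔ (v, a) ∈ first v := by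
    intro v h a
    simp only [d, if_pos h, Finset.mem_filter, Finset.mem_univ, true_and]
  have hd2 : ∀ v, ¬ (∃ E', Tight M g x E' ∧ ∃ a, (v, a) ∈ E') →
      ∀ a, a ∈ d v ↔ a ∈ M.enabled v ∧ M.expect x v a = x v := by
    intro v h a
    simp only [d, if_neg h, Finset.mem_filter]
  refine ⟨x, d, hx, fun v => ?_, fun v a ha => ?_, fun R hR hRd => ?_⟩
  · by_cases h : ∃ E', Tight M g x E' ∧ ∃ a, (v, a) ∈ E'
    · obtain ⟨⟨hT, a, ha⟩, -⟩ := hfirst v h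
      exact ⟨⟨a, (hd1 v h a).2 ha⟩, fun b hb => hT.1.enabled _ ((hd1 v h b).1 hb)⟩
    · refine ⟨?_, fun b hb => ((hd2 v h b).1 hb).1⟩
      obtain ⟨v', hr, hv'⟩ := hreach v
      rcases Relation.ReflTransGen.cases_head hr with rfl | ⟨w, ⟨a, ha, hopt, -⟩, -⟩
      · exact absurd hv' h
      · exact ⟨a, (hd2 v h a).2 ⟨ha, hopt⟩⟩
  · by_cases h : ∃ E', Tight M g x E' ∧ ∃ a, (v, a) ∈ E'
    · obtain ⟨⟨hT, -⟩, -⟩ := hfirst v h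
      have hva := (hd1 v h a).1 ha
      calc M.expect x v a = ∑ v', M.p v a v' * g (first v) := by
            refine Finset.sum_congr rfl fun v' _ => ?_
            rcases (M.p_nonneg v a v').eq_or_lt with h0 | h0
            · rw [← h0, zero_mul, zero_mul]
            · obtain ⟨a', ha'⟩ := hT.1.closed _ hva _ h0
              rw [hT.2 _ ha']
        _ = x v := by
            rw [← Finset.sum_mul, M.p_sum _ _ (hT.1.enabled _ hva), one_mul, ← hT.2 _ hva]
    · exact ((hd2 v h a).1 ha).2
  · have hmeet : ∃ v, (∃ a, (v, a) ∈ R) ∧ ∃ E', Tight M g x E' ∧ ∃ a, (v, a) ∈ E' := by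
      obtain ⟨⟨v, a⟩, hva⟩ := hR.nonempty
      obtain ⟨v', hr, hv'⟩ := hreach v
      have hvR : ∃ a, (v, a) ∈ R := ⟨a, hva⟩
      clear hva
      induction hr using Relation.ReflTransGen.head_induction_on with
      | refl => exact ⟨v', hvR, hv'⟩
      | head hst _ ih =>
        rename_i w w' _
        by_cases h : ∃ E', Tight M g x E' ∧ ∃ a, (w, a) ∈ E'
        · exact ⟨w, hvR, h⟩
        · obtain ⟨b, hb, hopt, hp⟩ := hst
          obtain ⟨a, ha⟩ := hvR
          exact ih (hR.closed _ ((hRd _ ha).2 b ((hd2 w h b).2 ⟨hb, hopt⟩)) w' hp)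
    obtain ⟨E, ⟨hE, v, ⟨b, hb⟩, ⟨a, ha⟩⟩, hEmin⟩ := Set.exists_min_image
      {E | Tight M g x E ∧ ∃ v, (∃ a, (v, a) ∈ R) ∧ ∃ a, (v, a) ∈ E} rk (Set.toFinite _) (by
        obtain ⟨v, hvR, E, hE, hvE⟩ := hmeet
        exact ⟨E, hE, v, hvR, hvE⟩)
    have hrow : ∀ w, (∃ a, (w, a) ∈ R) → (∃ a, (w, a) ∈ E) → ∀ a, (w, a) ∈ R ↔ (w, a) ∈ E := by
      rintro w ⟨c, hc⟩ hwE a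
      have h : ∃ E', Tight M g x E' ∧ ∃ a, (w, a) ∈ E' := ⟨E, hE, hwE⟩
      obtain ⟨⟨hT, hw⟩, hle⟩ := hfirst w h
      have hf : first w = E :=
        hrk (le_antisymm (hle E hE hwE) (hEmin _ ⟨hT, w, ⟨c, hc⟩, hw⟩))
      rw [← hf, ← hd1 w h]
      exact ⟨fun h => (hRd _ h).1, fun h => (hRd _ hc).2 a h⟩
    have hsub : ∀ {E₁ E₂ : Set (V × A)}, IsEC M E₁ → IsEC M E₂ →
        (∀ w, (∃ a, (w, a) ∈ E₁) → (∃ a, (w, a) ∈ E₂) → ∀ a, (w, a) ∈ E₁ ↔ (w, a) ∈ E₂) →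
        ∀ e ∈ E₁, e ∈ E₂ → E₁ ⊆ E₂ := by
      intro E₁ E₂ h₁ h₂ hrow e he he' e' he''
      have hstep : ∀ f f', PairStep M E₁ f f' → f ∈ E₂ → f' ∈ E₂ := by
        rintro f f' ⟨hf, hf', hp⟩ hf2
        exact (hrow f'.1 ⟨_, hf'⟩ (h₂.closed f hf2 _ hp) f'.2).1 hf'
      have := h₁.connected e he e' he''
      induction this with
      | single h => exact hstep _ _ h he'
      | tail _ h ih => exact hstep _ _ h (ih h.1)
    have hbE := (hrow v ⟨b, hb⟩ ⟨a, ha⟩ b).1 hb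
    have hRE : R = E := Set.Subset.antisymm (hsub hR hE.1 hrow _ hb hbE)
      (hsub hE.1 hR (fun w h1 h2 a => (hrow w h2 h1 a).symm) _ hbE hb)
    rw [hRE]
    exact hE.2

end EndComponents

section Limit

variable {V A : Type} [Fintype V] [Fintype A]

lemma eventually_mem_infSet {X : Type*} [Finite X] (f : ℕ → X) : ∀ᶠ n in atTop, f n ∈ infSet f := by
  have : ∀ᶠ n in atTop, ∀ x, x ∉ infSet f → f n ≠ x :=
    eventually_all.2 fun x => by
      by_cases hx : x ∈ infSet f
      · exact Eventually.of_forall fun _ h => absurd hx h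
      · exact (not_frequently.1 hx).mono fun _ h _ => h
  filter_upwards [this] with n hn
  by_contra h
  exact hn _ h rfl

lemma infSet_nonempty {X : Type*} [Finite X] (f : ℕ → X) : (infSet f).Nonempty :=
  (eventually_mem_infSet f).exists.imp' f fun _ h => h

lemma transGen_of_mem_infSet (M : MDP V A) {f : ℕ → V × A}
    (hf : ∀ n, 0 < M.p (f n).1 (f n).2 (f (n + 1)).1) {e₁ e₂ : V × A}
    (h₁ : e₁ ∈ infSet f) (h₂ : e₂ ∈ infSet f) :
    Relation.TransGen (PairStep M (infSet f)) e₁ e₂ := by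
  obtain ⟨N, hN⟩ := eventually_atTop.1 (eventually_mem_infSet f)
  obtain ⟨m, hm, rfl⟩ := frequently_atTop.1 h₁ N
  obtain ⟨k, hk, rfl⟩ := frequently_atTop.1 h₂ (m + 1)
  have hstep : ∀ n, N ≤ n → PairStep M (infSet f) (f n) (f (n + 1)) := fun n hn =>
    ⟨hN n hn, hN (n + 1) (by omega), hf n⟩
  clear h₁ h₂
  induction k, hk using Nat.le_induction with
  | base => exact .single (hstep m hm)
  | succ k hk ih => exact ih.tail (hstep k (by omega))

variable {M : MDP V A} {τ : M.Strategy} {α : V → ℝ}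

lemma sum_stepKernel_mul (h : List (V × A)) (F : V → ℝ) :
    ∑ i, stepKernel M τ α h i * F i.1 = ∑ v, nextState M α h v * F v := by
  rw [Fintype.sum_prod_type]
  refine Finset.sum_congr rfl fun v _ => ?_
  simp only [stepKernel]
  rw [← Finset.sum_mul, ← Finset.mul_sum, τ.act_sum, mul_one]

lemma Good.act_pos {i : V × A} {h : List (V × A)}
    (hg : Good (stepKernel M τ α) (i :: h)) : 0 < τ.act h i.1 i.2 := by
  refine lt_of_le_of_ne (τ.act_nonneg _ _ _) fun h0 => ?_
  have := hg.2
  rw [stepKernel, ← h0, mul_zero] at this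
  exact this.false

lemma Good.mem_enabled {i : V × A} {h : List (V × A)}
    (hg : Good (stepKernel M τ α) (i :: h)) : i.2 ∈ M.enabled i.1 := by
  by_contra hi
  exact (hg.act_pos).ne' (τ.act_support _ _ _ hi)

lemma Good.p_pos {i j : V × A} {h : List (V × A)}
    (hg : Good (stepKernel M τ α) (i :: j :: h)) : 0 < M.p j.1 j.2 i.1 := by
  refine lt_of_le_of_ne (M.p_nonneg _ _ _) fun h0 => ?_
  have := hg.2
  rw [stepKernel, nextState, ← h0, zero_mul] at this
  exact this.false

variable {Ω : Type*} [MeasurableSpace Ω] {μ : Measure Ω} [IsProbabilityMeasure μ]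

open Classical in
lemma IsProc.ae_exists_mem_infSet {ι : Type*} [Fintype ι] {J : Ω → ℕ → ι} {κ : List ι → ι → ℝ}
    (hJ : IsProc μ J κ) (P : ι → Prop) (e : ι) {c : ℝ} (hc : 0 < c)
    (hP : ∀ h, c ≤ ∑ i, if P i then κ (e :: h) i else 0) :
    ∀ᵐ ω ∂μ, e ∈ infSet (J ω) → ∃ i ∈ infSet (J ω), P i := by
  have := hJ.ae_frequently (A := fun h => h.head? = some e)
    (B := fun h => ∃ i, h.head? = some i ∧ P i) hc (by
      intro h _ hA
      obtain ⟨t, rfl⟩ : ∃ t, h = e :: t := by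
        cases h with
        | nil => simp at hA
        | cons a t => exact ⟨t, by simpa using hA⟩
      simpa using hP t)
  filter_upwards [this] with ω hω he
  rw [← frequently_iff_infSet]
  have h1 := frequently_add_one.2 (hω (frequently_add_one.1 (by simpa [pre, infSet] using he)))
  simpa [pre] using h1

variable {K : Ω → ℕ → V × A}

theorem IsProc.ae_isEC (hK : IsProc μ K (stepKernel M τ α)) :
    ∀ᵐ ω ∂μ, IsEC M (infSet (K ω)) := by
  classical
  have hcl : ∀ (e : V × A) (v : V), ∀ᵐ ω ∂μ, 0 < M.p e.1 e.2 v →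
      e ∈ infSet (K ω) → ∃ i ∈ infSet (K ω), i.1 = v := by
    intro e v
    by_cases hp : 0 < M.p e.1 e.2 v
    · filter_upwards [hK.ae_exists_mem_infSet (fun i => i.1 = v) e hp (by
        intro h
        have := sum_stepKernel_mul (M := M) (τ := τ) (α := α) (e :: h)
          (fun w => if w = v then 1 else 0)
        simp only [mul_ite, mul_one, mul_zero] at this
        rw [this]
        simp [nextState])] with ω hω _ using hω
    · exact ae_of_all _ fun _ h => absurd h hp
  filter_upwards [hK.ae_good, ae_all_iff.2 fun e => ae_all_iff.2 (hcl e)] with ω hg hc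
  refine ⟨infSet_nonempty _, fun e he => ?_, fun e he v hv => ?_, fun e₁ h₁ e₂ h₂ => ?_⟩
  · obtain ⟨n, rfl⟩ := Frequently.exists he
    exact (hg (n + 1)).mem_enabled
  · obtain ⟨i, hi, rfl⟩ := hc e v hv he
    exact ⟨i.2, hi⟩
  · exact transGen_of_mem_infSet M (fun n => (hg (n + 2)).p_pos) h₁ h₂

/-- A function of the current state, as a function of the history. -/
def lastState (x : V → ℝ) (c : ℝ) : List (V × A) → ℝ
  | [] => c
  | e :: _ => x e.1

lemma IsProc.integral_state_le (hK : IsProc μ K (stepKernel M τ α))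
    {x : V → ℝ} (hx : ∀ h, ∀ e : V × A, Good (stepKernel M τ α) (e :: h) →
      M.expect x e.1 e.2 ≤ x e.1) (n : ℕ) :
    ∫ ω, x (K ω n).1 ∂μ ≤ ∑ v, α v * x v := by
  have key : ∀ n, ∫ ω, lastState x (∑ v, α v * x v) (pre (K ω) n) ∂μ ≤ ∑ v, α v * x v := by
    intro n
    induction n with
    | zero => simp [pre, lastState]
    | succ n ih =>
      refine (hK.integral_step_le n fun h _ hg _ => ?_).trans ih
      rw [show (fun i => stepKernel M τ α h i * lastState x (∑ v, α v * x v) (i :: h)) =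
        fun i => stepKernel M τ α h i * x i.1 from rfl, sum_stepKernel_mul]
      cases h with
      | nil => exact le_rfl
      | cons e h => exact hx h e hg
  exact key (n + 1)

lemma IsProc.measurable_apply {ι : Type*} [Fintype ι] {J : Ω → ℕ → ι} {κ : List ι → ι → ℝ}
    (hJ : IsProc μ J κ) (n : ℕ) {β : Type*} [MeasurableSpace β] [Inhabited β] (F : ι → β) :
    Measurable fun ω => F (J ω n) :=
  hJ.measurable_comp_pre (n + 1) fun h => (h.head?.map F).getD default

lemma measurable_infSet {ι : Type*} [Finite ι] {J : Ω → ℕ → ι}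
    (hm : ∀ n e, MeasurableSet {ω | J ω n = e}) {β : Type*} [MeasurableSpace β] (g : Set ι → β) :
    Measurable fun ω => g (infSet (J ω)) := by
  let _ : MeasurableSpace (Set ι) := ⊤
  refine (measurable_from_top (f := g)).comp
    (measurable_to_countable' (f := fun ω => infSet (J ω)) fun E => ?_)
  have : (fun ω => infSet (J ω)) ⁻¹' {E} =
      ⋂ e, {ω | (∃ᶠ n in atTop, J ω n = e) ↔ e ∈ E} := by
    ext ω; simp [Set.ext_iff, infSet]
  rw [this]
  refine MeasurableSet.iInter fun e => ?_
  have hf : MeasurableSet {ω | ∃ᶠ n in atTop, J ω n = e} := by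
    have : {ω | ∃ᶠ n in atTop, J ω n = e} = ⋂ N, ⋃ n, ⋃ (_ : N ≤ n), {ω | J ω n = e} := by
      ext ω; simp [frequently_atTop]
    rw [this]
    exact MeasurableSet.iInter fun N => MeasurableSet.iUnion fun n =>
      MeasurableSet.iUnion fun _ => hm n e
  by_cases he : e ∈ E
  · simp only [he, iff_true]
    exact hf
  · simp only [he, iff_false]
    exact hf.compl

lemma IsProc.measurable_infSet {ι : Type*} [Fintype ι] {J : Ω → ℕ → ι} {κ : List ι → ι → ℝ}
    (hJ : IsProc μ J κ) {β : Type*} [MeasurableSpace β] (g : Set ι → β) :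
    Measurable fun ω => g (infSet (J ω)) :=
  MDP.measurable_infSet (fun n e => by
    let _ : MeasurableSpace Prop := ⊤
    exact measurableSet_setOfPred.2 (hJ.measurable_apply n fun i => i = e)) g

lemma IsProc.integral_infSet_le (hK : IsProc μ K (stepKernel M τ α))
    {g : Set (V × A) → ℝ} {x : V → ℝ} (hx : Feasible M g x) :
    ∫ ω, g (infSet (K ω)) ∂μ ≤ ∑ v, α v * x v := by
  obtain ⟨C, hC⟩ := (Set.finite_range fun E => ‖g E‖).bddAbove
  obtain ⟨D, hD⟩ := (Set.finite_range fun v => ‖x v‖).bddAbove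
  have hC' : ∀ E, ‖g E‖ ≤ C := fun E => hC ⟨E, rfl⟩
  have hD' : ∀ v, ‖x v‖ ≤ D := fun v => hD ⟨v, rfl⟩
  have hmg := hK.measurable_infSet g
  have hmx : ∀ n, Measurable fun ω => x (K ω n).1 := fun n => hK.measurable_apply n fun e => x e.1
  have hb : ∀ n ω, ‖min (g (infSet (K ω))) (x (K ω n).1)‖ ≤ max C D := by
    intro n ω
    rcases min_choice (g (infSet (K ω))) (x (K ω n).1) with h | h <;> rw [h]
    · exact (hC' _).trans (le_max_left _ _)
    · exact (hD' _).trans (le_max_right _ _)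
  have hlim : Tendsto (fun n => ∫ ω, min (g (infSet (K ω))) (x (K ω n).1) ∂μ) atTop
      (nhds (∫ ω, g (infSet (K ω)) ∂μ)) := by
    refine tendsto_integral_of_dominated_convergence (fun _ => max C D)
      (fun n => (hmg.min (hmx n)).aestronglyMeasurable) (integrable_const _)
      (fun n => ae_of_all _ (hb n)) ?_
    filter_upwards [hK.ae_isEC] with ω hω
    refine tendsto_const_nhds.congr' ?_
    filter_upwards [eventually_mem_infSet (K ω)] with n hn
    exact (min_eq_left (hx.2 _ hω _ hn)).symm
  refine le_of_tendsto hlim (Eventually.of_forall fun n => ?_)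
  refine le_trans ?_ (hK.integral_state_le (x := x)
    (fun h e hg => hx.1 _ _ (hg.mem_enabled)) n)
  refine integral_mono ?_ ?_ fun ω => min_le_right _ _
  · exact Integrable.of_bound (hmg.min (hmx n)).aestronglyMeasurable _ (ae_of_all _ (hb n))
  · exact Integrable.of_bound (hmx n).aestronglyMeasurable D (ae_of_all _ fun ω => hD' _)

open Classical in
lemma IsProc.integral_infSet_eq (hK : IsProc μ K (stepKernel M τ α))
    {g : Set (V × A) → ℝ} {x : V → ℝ} {d : V → Finset A} {ρ : V → A → ℝ}
    (hτ : ∀ h v a, τ.act h v a = ρ v a) (hρ : ∀ v a, 0 < ρ v a ↔ a ∈ d v)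
    (hx : ∀ v, ∀ a ∈ d v, M.expect x v a = x v)
    (hd : ∀ R, IsEC M R → (∀ e ∈ R, e.2 ∈ d e.1 ∧ ∀ a ∈ d e.1, (e.1, a) ∈ R) →
      ∀ e ∈ R, x e.1 = g R) :
    ∫ ω, g (infSet (K ω)) ∂μ = ∑ v, α v * x v := by
  obtain ⟨D, hD⟩ := (Set.finite_range fun v => ‖x v‖).bddAbove
  have hD' : ∀ v, ‖x v‖ ≤ D := fun v => hD ⟨v, rfl⟩
  have hmx : ∀ n, Measurable fun ω => x (K ω n).1 := fun n => hK.measurable_apply n fun e => x e.1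
  have hgood : ∀ h e, Good (stepKernel M τ α) (e :: h) → e.2 ∈ d e.1 := fun h e hg => by
    rw [← hρ, ← hτ h]; exact hg.act_pos
  have hmem : ∀ (e : V × A) (v : V) (a : A), ∀ᵐ ω ∂μ, 0 < M.p e.1 e.2 v → a ∈ d v →
      e ∈ infSet (K ω) → (v, a) ∈ infSet (K ω) := by
    intro e v a
    by_cases hp : 0 < M.p e.1 e.2 v ∧ a ∈ d v
    · have h2 := hp.2
      rw [← hρ] at h2
      filter_upwards [hK.ae_exists_mem_infSet (fun i => i = (v, a)) e (mul_pos hp.1 h2) (by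
        intro h
        rw [Fintype.sum_eq_single (v, a), if_pos rfl, stepKernel, hτ]
        · rfl
        · exact fun i hi => if_neg hi)] with ω hω _ _ he
      obtain ⟨i, hi, rfl⟩ := hω he
      exact hi
    · exact ae_of_all _ fun _ h h' => absurd ⟨h, h'⟩ hp
  have hlim : Tendsto (fun n => ∫ ω, x (K ω n).1 ∂μ) atTop
      (nhds (∫ ω, g (infSet (K ω)) ∂μ)) := by
    refine tendsto_integral_of_dominated_convergence (fun _ => D)
      (fun n => (hmx n).aestronglyMeasurable) (integrable_const _)
      (fun n => ae_of_all _ fun ω => hD' _) ?_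
    filter_upwards [hK.ae_isEC, hK.ae_good,
      ae_all_iff.2 fun e => ae_all_iff.2 fun v => ae_all_iff.2 (hmem e v)] with ω hω hg hm
    have hR := hd _ hω fun e he => by
      constructor
      · obtain ⟨n, rfl⟩ := Frequently.exists he
        exact hgood _ _ (hg (n + 1))
      · intro a ha
        obtain ⟨e', -, he'⟩ := Relation.TransGen.tail'_iff.1 (hω.connected e he e he)
        exact hm e' e.1 a he'.2.2 ha he'.1
    refine tendsto_const_nhds.congr' ?_
    filter_upwards [eventually_mem_infSet (K ω)] with n hn
    exact (hR _ hn).symm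
  refine tendsto_nhds_unique hlim (tendsto_const_nhds.congr fun n => ?_)
  refine le_antisymm ?_ ?_
  · have := hK.integral_state_le (x := fun v => - x v)
      (fun h e hg => by
        have := hx _ _ (hgood _ _ hg)
        simp only [expect, mul_neg, Finset.sum_neg_distrib] at this ⊢
        rw [this]) n
    simp only [mul_neg, Finset.sum_neg_distrib, integral_neg] at this
    linarith
  · exact hK.integral_state_le (fun h e hg => (hx _ _ (hgood _ _ hg)).le) n

end Limit

section Product

variable {V A Q : Type} [Fintype V] [Fintype A] [Fintype Q]

open Classical in
/-- The product of an MDP with a deterministic automaton reading the visited states. -/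
noncomputable def prod (M : MDP V A) (t : Q → V → Q) : MDP (V × Q) A where
  enabled z := M.enabled z.1
  enabled_nonempty z := M.enabled_nonempty z.1
  p z a z' := if z'.2 = t z.2 z.1 then M.p z.1 a z'.1 else 0
  p_nonneg z a z' := by split_ifs; exacts [M.p_nonneg _ _ _, le_rfl]
  p_sum z a ha := by
    rw [Fintype.sum_prod_type]
    simpa using M.p_sum z.1 a ha

open Classical in
/-- The initial distribution of the product. -/
noncomputable def prodInit (α : V → ℝ) (q₀ : Q) (z : V × Q) : ℝ :=
  if z.2 = q₀ then α z.1 else 0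

lemma prodInit_nonneg {α : V → ℝ} (hα : ∀ v, 0 ≤ α v) (q₀ : Q) (z : V × Q) :
    0 ≤ prodInit α q₀ z := by
  unfold prodInit
  split_ifs
  exacts [hα _, le_rfl]

variable (t : Q → V → Q) (q₀ : Q)

/-- The state of the automaton after reading a history. -/
def memAt : List (V × A) → Q
  | [] => q₀
  | e :: h => t (memAt h) e.1

/-- The history of the product corresponding to a history of the MDP. -/
def liftHist : List (V × A) → List ((V × Q) × A)
  | [] => []
  | e :: h => ((e.1, memAt t q₀ h), e.2) :: liftHist h

lemma liftHist_injective : Function.Injective (liftHist (A := A) t q₀) := by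
  intro h
  induction h with
  | nil =>
    intro h' he
    cases h' with
    | nil => rfl
    | cons e h' => cases he
  | cons e h ih =>
    intro h' he
    cases h' with
    | nil => cases he
    | cons e' h' =>
      simp only [liftHist, List.cons.injEq, Prod.mk.injEq] at he
      rw [ih he.2, Prod.ext he.1.1.1 he.1.2]

/-- The trajectory of the product corresponding to a trajectory of the MDP. -/
def liftSeq (f : ℕ → V × A) (n : ℕ) : (V × Q) × A :=
  (((f n).1, memAt t q₀ (pre f n)), (f n).2)

lemma pre_liftSeq (f : ℕ → V × A) (n : ℕ) : pre (liftSeq t q₀ f) n = liftHist t q₀ (pre f n) := by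
  induction n with
  | zero => rfl
  | succ n ih => rw [pre, ih]; rfl

variable {t q₀} {M : MDP V A}

lemma nextState_liftHist (α : V → ℝ) (h : List (V × A)) (z : V × Q) :
    nextState (M.prod t) (prodInit α q₀) (liftHist t q₀ h) z =
      prodInit (nextState M α h) (memAt t q₀ h) z := by
  cases h <;> rfl

variable {Ω : Type*} [MeasurableSpace Ω] {μ : Measure Ω} [IsProbabilityMeasure μ]

lemma IsProc.lift {σ : M.Strategy} {α : V → ℝ} (hα : ∀ v, 0 ≤ α v) {J : Ω → ℕ → V × A}
    (hJ : IsProc μ J (stepKernel M σ α)) {τ : (M.prod t).Strategy}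
    (hτ : ∀ h v a, τ.act (liftHist t q₀ h) (v, memAt t q₀ h) a = σ.act h v a) :
    IsProc μ (fun ω => liftSeq t q₀ (J ω)) (stepKernel (M.prod t) τ (prodInit α q₀)) where
  meas n h := by
    let _ : MeasurableSpace Prop := ⊤
    simp_rw [pre_liftSeq]
    exact measurableSet_setOfPred.2 (hJ.measurable_comp_pre n fun h' => liftHist t q₀ h' = h)
  nonneg h z := by
    refine mul_nonneg ?_ (τ.act_nonneg _ _ _)
    cases h with
    | nil => exact prodInit_nonneg hα _ _
    | cons e h => exact (M.prod t).p_nonneg _ _ _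
  step n h' z := by
    simp_rw [pre_liftSeq]
    by_cases hh : ∃ h, liftHist t q₀ h = h'
    · obtain ⟨h, rfl⟩ := hh
      simp_rw [(liftHist_injective t q₀).eq_iff, stepKernel, nextState_liftHist]
      obtain ⟨⟨v, q⟩, a⟩ := z
      by_cases hq : q = memAt t q₀ h
      · subst hq
        have h1 : {ω | pre (J ω) n = h ∧ liftSeq t q₀ (J ω) n = ((v, memAt t q₀ h), a)} =
            {ω | pre (J ω) n = h ∧ J ω n = (v, a)} := by
          ext ω
          refine and_congr_right fun hp => ?_
          simp [liftSeq, hp, Prod.ext_iff]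
        rw [h1, hJ.step, hτ, prodInit, if_pos rfl, stepKernel]
      · have h1 : {ω | pre (J ω) n = h ∧ liftSeq t q₀ (J ω) n = ((v, q), a)} = ∅ := by
          rw [Set.eq_empty_iff_forall_notMem]
          rintro ω ⟨hp, he⟩
          simp only [liftSeq, hp, Prod.mk.injEq] at he
          exact hq he.1.2.symm
        rw [h1, prodInit, if_neg hq]
        simp
    · have h1 : ∀ h, liftHist t q₀ h ≠ h' := fun h he => hh ⟨h, he⟩
      simp [h1]

open Classical in
/-- The uniform distribution on a finite set of actions. -/
noncomputable def unifOn (s : Finset A) (a : A) : ℝ := if a ∈ s then (s.card : ℝ)⁻¹ else 0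

lemma unifOn_nonneg (s : Finset A) (a : A) : 0 ≤ unifOn s a := by
  unfold unifOn
  split_ifs <;> positivity

lemma unifOn_pos_iff (s : Finset A) (a : A) : 0 < unifOn s a ↔ a ∈ s := by
  unfold unifOn
  split_ifs with h
  · have : 0 < s.card := Finset.card_pos.2 ⟨a, h⟩
    simp only [h, iff_true]
    positivity
  · simp [h]

lemma sum_unifOn {s : Finset A} (hs : s.Nonempty) : ∑ a, unifOn s a = 1 := by
  have : (s.card : ℝ) ≠ 0 := by exact_mod_cast hs.card_pos.ne'
  simp [unifOn, this]

/-- The positional selectors of nonempty sets of enabled actions. -/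
abbrev Selector (N : MDP V A) : Type :=
  {d : V → Finset A // ∀ v, (d v).Nonempty ∧ d v ⊆ N.enabled v}

noncomputable instance (N : MDP V A) : Fintype N.Selector := Fintype.ofFinite _

/-- The strategy playing uniformly the actions of a selector. -/
noncomputable def Selector.strategy {N : MDP V A} (d : N.Selector) : N.Strategy where
  act _ v a := unifOn (d.1 v) a
  act_nonneg _ _ _ := unifOn_nonneg _ _
  act_support _ _ _ ha := if_neg fun h => ha ((d.2 _).2 h)
  act_sum _ v := sum_unifOn (d.2 v).1

variable (q₀) in
/-- The strategy playing uniformly the actions of a selector of the product. -/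
noncomputable def Selector.memStrategy (d : (M.prod t).Selector) : M.Strategy where
  act h v a := unifOn (d.1 (v, memAt t q₀ h)) a
  act_nonneg _ _ _ := unifOn_nonneg _ _
  act_support _ _ _ ha := if_neg fun h => ha ((d.2 _).2 h)
  act_sum _ _ := sum_unifOn (d.2 _).1

/-- A strategy of the MDP seen as a strategy of the product. -/
noncomputable def Strategy.prod (σ : M.Strategy) (t : Q → V → Q) : (M.prod t).Strategy where
  act h z a := σ.act (h.map fun e => (e.1.1, e.2)) z.1 a
  act_nonneg _ _ _ := σ.act_nonneg _ _ _
  act_support _ _ _ ha := σ.act_support _ _ _ ha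
  act_sum _ _ := σ.act_sum _ _

lemma map_liftHist (h : List (V × A)) :
    ((liftHist t q₀ h).map fun e => (e.1.1, e.2)) = h := by
  induction h with
  | nil => rfl
  | cons e h ih => rw [liftHist, List.map_cons, ih]

variable [DecidableEq V] [Nonempty V] [Nonempty A]

lemma isDist_diracD (u : V) : IsDist (diracD u) := by
  constructor
  · intro v
    unfold diracD
    split_ifs <;> norm_num
  · simp [diracD]

lemma stepKernel_nonneg (σ : M.Strategy) {α : V → ℝ} (hα : ∀ v, 0 ≤ α v) (h : List (V × A))
    (i : V × A) : 0 ≤ stepKernel M σ α h i := by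
  refine mul_nonneg ?_ (σ.act_nonneg _ _ _)
  cases h with
  | nil => exact hα _
  | cons e h => exact M.p_nonneg _ _ _

lemma isProc_traj (σ : M.Strategy) (u : V) :
    IsProc seedMeasure (M.traj σ (diracD u)) (stepKernel M σ (diracD u)) where
  meas n h := pastUnif_le _ _ (measurableSet_pre_traj_eq M σ _ n h)
  nonneg := stepKernel_nonneg σ (isDist_diracD u).1
  step := seedMeasure_pre_traj_step M σ (isDist_diracD u)

theorem exists_value_and_optimal_selector [Nonempty Q] (g : Set ((V × Q) × A) → ℝ) (u : V) :
    ∃ d : (M.prod t).Selector, ∀ σ : M.Strategy,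
      ∫ s, g (infSet (liftSeq t q₀ (M.traj σ (diracD u) s))) ∂seedMeasure ≤
        ∫ s, g (infSet (liftSeq t q₀ (M.traj (d.memStrategy q₀) (diracD u) s))) ∂seedMeasure := by
  obtain ⟨x, d, hx, hd, hdx, hR⟩ := exists_value_and_selector (M.prod t) g
  refine ⟨⟨d, hd⟩, fun σ => ?_⟩
  have h1 := ((isProc_traj σ u).lift (t := t) (q₀ := q₀) (τ := σ.prod t) (isDist_diracD u).1
    (fun h v a => by simp only [Strategy.prod, map_liftHist])).integral_infSet_le hx
  have h2 := ((isProc_traj (Selector.memStrategy q₀ ⟨d, hd⟩) u).lift (t := t) (q₀ := q₀)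
    (τ := Selector.strategy ⟨d, hd⟩) (isDist_diracD u).1
    (fun _ _ _ => rfl)).integral_infSet_eq (g := g) (fun _ v a => rfl)
      (fun v a => unifOn_pos_iff (d v) a) hdx hR
  exact h1.trans h2.ge

lemma PrEvent_eq (σ : M.Strategy) (α : V → ℝ) (E : Set (ℕ → V)) :
    M.PrEvent σ α E = seedMeasure.real {s | M.stateAt σ α s ∈ E} := by
  rw [PrEvent, Measure.real, seedMeasure, Measure.restrict_apply' measurableSet_Icc,
    Set.inter_comm]
  rfl

lemma memAt_pre_eq_detRun {S : Type} (step : Q → S → Q) (ℓ : V → S) (f : ℕ → V × A) (n : ℕ) :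
    memAt (fun q v => step q (ℓ v)) q₀ (pre f n) = detRun q₀ step (fun n => ℓ (f n).1) n := by
  induction n with
  | zero => rfl
  | succ n ih => rw [pre, memAt, ih]; rfl

open Classical in
lemma PrOmega_eq_integral {S : Type} {L : Set (ℕ → S)} {step : Q → S → Q} {acc : Set Q → Prop}
    (hL : ∀ w, w ∈ L ↔ acc (infSet (detRun q₀ step w))) (σ : M.Strategy) (u : V) (ℓ : V → S) :
    M.PrOmega σ u ℓ L = ∫ s, (if acc ((fun e => e.1.2) '' infSet (liftSeq
      (fun q v => step q (ℓ v)) q₀ (M.traj σ (diracD u) s))) then 1 else 0) ∂seedMeasure := by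
  have hset : {s | M.stateAt σ (diracD u) s ∈ {w | (fun n => ℓ (w n)) ∈ L}} =
      {s | acc ((fun e => e.1.2) '' infSet (liftSeq
        (fun q v => step q (ℓ v)) q₀ (M.traj σ (diracD u) s)))} := by
    ext s
    simp only [Set.mem_ofPred_eq]
    rw [hL, ← infSet_comp]
    simp only [liftSeq, memAt_pre_eq_detRun]
    rfl
  have hm : MeasurableSet {s | acc ((fun e => e.1.2) '' infSet (liftSeq
      (fun q v => step q (ℓ v)) q₀ (M.traj σ (diracD u) s)))} := by
    let _ : MeasurableSpace Prop := ⊤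
    exact measurableSet_setOfPred.2 (((isProc_traj σ u).lift (τ := σ.prod _) (isDist_diracD u).1
      (fun h v a => by simp only [Strategy.prod, map_liftHist])).measurable_infSet
        fun E => acc ((fun e => e.1.2) '' E))
  rw [PrOmega, PrEvent_eq, hset, ← integral_indicator_one hm]
  rfl

theorem exists_mixture {S : Type} {k : ℕ} {L : Fin k → Set (ℕ → S)} {step : Q → S → Q}
    {acc : Fin k → Set Q → Prop} (hL : ∀ i w, w ∈ L i ↔ acc i (infSet (detRun q₀ step w)))
    (σ : M.Strategy) (u : V) (ℓ : V → S) :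
    ∃ c ∈ stdSimplex ℝ (M.prod fun q v => step q (ℓ v)).Selector, ∀ i,
      M.PrOmega σ u ℓ (L i) = ∑ d, c d * M.PrOmega (d.memStrategy q₀) u ℓ (L i) := by
  classical
  have : Nonempty Q := ⟨q₀⟩
  let P : M.Strategy → Fin k → ℝ := fun σ i => M.PrOmega σ u ℓ (L i)
  let T : ((M.prod fun q v => step q (ℓ v)).Selector → ℝ) →ₗ[ℝ] (Fin k → ℝ) :=
    { toFun := fun c => ∑ d, c d • P (d.memStrategy q₀)
      map_add' := fun c c' => by simp [add_smul, Finset.sum_add_distrib]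
      map_smul' := fun r c => by simp [Finset.smul_sum, smul_smul] }
  by_cases hmem : P σ ∈ T '' stdSimplex ℝ _
  · obtain ⟨c, hc, he⟩ := hmem
    refine ⟨c, hc, fun i => ?_⟩
    have := congrFun he i
    simp only [T, LinearMap.coe_mk, AddHom.coe_mk, Finset.sum_apply, Pi.smul_apply,
      smul_eq_mul] at this
    exact this.symm
  · exfalso
    obtain ⟨F, r, hF, hr⟩ := geometric_hahn_banach_closed_point
      ((convex_stdSimplex ℝ _).linear_image T)
      (((isCompact_stdSimplex ℝ _).image T.continuous_of_finiteDimensional).isClosed) hmem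
    have hFsum : ∀ y, F y = ∑ i, F (Pi.single i 1) * y i := by
      intro y
      conv_lhs => rw [← Finset.univ_sum_single y]
      rw [map_sum]
      refine Finset.sum_congr rfl fun i _ => ?_
      rw [mul_comm, ← smul_eq_mul, ← map_smul, ← Pi.single_smul, smul_eq_mul, mul_one]
    let g : Set ((V × Q) × A) → ℝ := fun E =>
      ∑ i, F (Pi.single i 1) * if acc i ((fun e => e.1.2) '' E) then 1 else 0
    have hFP : ∀ σ : M.Strategy, F (P σ) = ∫ s, g (infSet (liftSeq (fun q v => step q (ℓ v)) q₀
        (M.traj σ (diracD u) s))) ∂seedMeasure := by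
      intro σ
      have hproc := (isProc_traj σ u).lift (t := fun q v => step q (ℓ v)) (q₀ := q₀)
        (τ := σ.prod _) (isDist_diracD u).1
        (fun h v a => by simp only [Strategy.prod, map_liftHist])
      rw [hFsum, integral_finsetSum]
      · refine Finset.sum_congr rfl fun i _ => ?_
        rw [integral_const_mul]
        congr 1
        exact PrOmega_eq_integral (hL i) σ u ℓ
      · intro i _
        refine Integrable.const_mul (Integrable.of_bound (μ := seedMeasure) (C := 1)
          (hproc.measurable_infSet
          fun E => if acc i ((fun e => e.1.2) '' E) then (1 : ℝ) else 0).aestronglyMeasurable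
            (ae_of_all _ fun s => ?_)) _
        split_ifs <;> simp
    obtain ⟨d, hd⟩ := exists_value_and_optimal_selector (M := M)
      (t := fun q v => step q (ℓ v)) (q₀ := q₀) g u
    have h1 := hF (P (d.memStrategy q₀)) ⟨Pi.single d 1, single_mem_stdSimplex ℝ d, by
      simp only [T, LinearMap.coe_mk, AddHom.coe_mk]
      rw [Fintype.sum_eq_single d]
      · simp
      · intro d' hd'
        simp [hd']⟩
    have h2 := hd σ
    rw [← hFP, ← hFP] at h2
    linarith

end Product

section FiniteMemory

variable {V A Q : Type} [Fintype V] [Fintype A] [Fintype Q] [Nonempty V] [Nonempty A]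
variable (M : MDP V A) (C : M.FinMem) (u : V)

/-- The state-action sequence of a run under a finite-memory strategy. -/
noncomputable def trajFM (x : ℝ) (n : ℕ) : V × A :=
  ((M.runFM C u x n).1.1, (M.runFM C u x n).2)

lemma runFM_snd (x : ℝ) (n : ℕ) : (M.runFM C u x n).2 =
    sample (C.actF (M.runFM C u x n).1.2 (M.runFM C u x n).1.1) (unif (3 * n) x) := by
  cases n <;> rfl

/-- The event of a given history followed by a given state and memory value. -/
def arriveFM (n : ℕ) (h : List (V × A)) (v : V) (q : Fin (C.m + 1)) : Set ℝ :=
  {x | pre (M.trajFM C u x) n = h ∧ (M.runFM C u x n).1 = (v, q)}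

/-- The event of a given history followed by a given state, action and memory value. -/
def chooseFM (n : ℕ) (h : List (V × A)) (e : V × A) (q : Fin (C.m + 1)) : Set ℝ :=
  {x | pre (M.trajFM C u x) n = h ∧ M.runFM C u x n = ((e.1, q), e.2)}

lemma chooseFM_eq (n : ℕ) (h : List (V × A)) (e : V × A) (q : Fin (C.m + 1)) :
    M.chooseFM C u n h e q =
      M.arriveFM C u n h e.1 q ∩ {x | sample (C.actF q e.1) (unif (3 * n) x) = e.2} := by
  ext x
  simp only [chooseFM, arriveFM, Set.mem_ofPred_eq, Set.mem_inter_iff, and_assoc]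
  refine and_congr_right fun _ => ?_
  rw [Prod.ext_iff]
  refine and_congr_right fun h1 => ?_
  simp only at h1 ⊢
  rw [runFM_snd, h1]

lemma arriveFM_succ (n : ℕ) (h : List (V × A)) (e : V × A) (v : V) (q' : Fin (C.m + 1)) :
    M.arriveFM C u (n + 1) (e :: h) v q' = ⋃ q ∈ (Finset.univ : Finset (Fin (C.m + 1))),
      ((M.chooseFM C u n h e q ∩ {x | sample (M.p e.1 e.2) (unif (3 * n + 1) x) = v}) ∩
        {x | sample (C.upd q e.1 e.2 v) (unif (3 * n + 2) x) = q'}) := by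
  ext x
  simp only [arriveFM, chooseFM, Set.mem_ofPred_eq, Set.mem_iUnion, Finset.mem_univ,
    Set.mem_inter_iff, exists_prop, true_and, pre, List.cons.injEq]
  constructor
  · rintro ⟨⟨he, hp⟩, hr⟩
    subst he
    have h1 : sample (M.p (M.trajFM C u x n).1 (M.trajFM C u x n).2) (unif (3 * n + 1) x) = v :=
      congrArg Prod.fst hr
    refine ⟨(M.runFM C u x n).1.2, ⟨⟨hp, rfl⟩, h1⟩, ?_⟩
    rw [← h1]
    exact congrArg Prod.snd hr
  · rintro ⟨q, ⟨⟨hp, hr⟩, hv⟩, hq⟩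
    refine ⟨⟨by rw [trajFM, hr], hp⟩, ?_⟩
    simp only [runFM, hr]
    rw [hv, hq]

lemma measurableSet_arriveFM (n : ℕ) (h : List (V × A)) (v : V) (q : Fin (C.m + 1)) :
    MeasurableSet[pastUnif (3 * n)] (M.arriveFM C u n h v q) := by
  induction n generalizing h v q with
  | zero => exact @MeasurableSet.const _ (pastUnif _) ([] = h ∧ (u, C.init) = (v, q))
  | succ n ih =>
    cases h with
    | nil => simp [arriveFM, pre]
    | cons e h =>
      rw [arriveFM_succ]
      refine Finset.measurableSet_biUnion _ fun q' _ => ?_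
      refine MeasurableSet.inter (MeasurableSet.inter ?_ ?_) ?_
      · rw [chooseFM_eq]
        exact MeasurableSet.inter (pastUnif_mono (by omega) _ (ih h e.1 q'))
          (measurableSet_sample_unif _ _ (by omega))
      · exact measurableSet_sample_unif _ _ (by omega)
      · exact measurableSet_sample_unif _ _ (by omega)

lemma measurableSet_chooseFM (n : ℕ) (h : List (V × A)) (e : V × A) (q : Fin (C.m + 1)) :
    MeasurableSet[pastUnif (3 * n + 1)] (M.chooseFM C u n h e q) := by
  rw [chooseFM_eq]
  exact MeasurableSet.inter (pastUnif_mono (by omega) _ (measurableSet_arriveFM M C u n h e.1 q))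
    (measurableSet_sample_unif _ _ (by omega))

lemma real_chooseFM (n : ℕ) (h : List (V × A)) (e : V × A) (q : Fin (C.m + 1)) :
    seedMeasure.real (M.chooseFM C u n h e q) =
      seedMeasure.real (M.arriveFM C u n h e.1 q) * C.actF q e.1 e.2 := by
  rw [chooseFM_eq, seedMeasure_inter_sample (measurableSet_arriveFM M C u n h e.1 q)
    (C.actF_nonneg _ _) (C.actF_sum _ _)]

lemma real_arriveFM_succ (n : ℕ) (h : List (V × A)) (e : V × A) (v : V) (q' : Fin (C.m + 1)) :
    seedMeasure.real (M.arriveFM C u (n + 1) (e :: h) v q') =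
      ∑ q, seedMeasure.real (M.chooseFM C u n h e q) * M.p e.1 e.2 v * C.upd q e.1 e.2 v q' := by
  have hm : ∀ q, MeasurableSet[pastUnif (3 * n + 2)]
      (M.chooseFM C u n h e q ∩ {x | sample (M.p e.1 e.2) (unif (3 * n + 1) x) = v}) := fun q =>
    MeasurableSet.inter (pastUnif_mono (by omega) _ (measurableSet_chooseFM M C u n h e q))
      (measurableSet_sample_unif _ _ (by omega))
  rw [arriveFM_succ, measureReal_biUnion_finset]
  · refine Finset.sum_congr rfl fun q _ => ?_
    rw [seedMeasure_inter_sample (hm q) (C.upd_nonneg _ _ _ _) (C.upd_sum _ _ _ _)]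
    congr 1
    by_cases he : e.2 ∈ M.enabled e.1
    · exact seedMeasure_inter_sample (measurableSet_chooseFM M C u n h e q) (M.p_nonneg _ _)
        (M.p_sum _ _ he) v
    · have h0 : seedMeasure.real (M.chooseFM C u n h e q) = 0 := by
        rw [real_chooseFM, C.actF_support _ _ _ he, mul_zero]
      rw [h0, zero_mul]
      refine le_antisymm ?_ measureReal_nonneg
      rw [← h0]
      exact measureReal_mono Set.inter_subset_left
  · intro q _ q₁ _ hne
    refine Set.disjoint_left.2 fun x hx hx₁ => hne ?_
    have h1 := hx.1.1.2.symm.trans hx₁.1.1.2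
    simpa using h1
  · intro q _
    exact MeasurableSet.inter (pastUnif_le _ _ (hm q))
      (pastUnif_le _ _ (measurableSet_sample_unif _ _ (Nat.lt_succ_self _)))

lemma setOf_pre_trajFM_succ (n : ℕ) (e : V × A) (h : List (V × A)) :
    {x | pre (M.trajFM C u x) (n + 1) = e :: h} =
      ⋃ q ∈ (Finset.univ : Finset (Fin (C.m + 1))), M.chooseFM C u n h e q := by
  ext x
  simp only [chooseFM, Set.mem_ofPred_eq, Set.mem_iUnion, Finset.mem_univ, exists_prop, true_and,
    pre, List.cons.injEq]
  constructor
  · rintro ⟨rfl, hp⟩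
    exact ⟨(M.runFM C u x n).1.2, hp, rfl⟩
  · rintro ⟨q, hp, hr⟩
    exact ⟨by rw [trajFM, hr], hp⟩

lemma measurableSet_pre_trajFM (n : ℕ) (h : List (V × A)) :
    MeasurableSet {x | pre (M.trajFM C u x) n = h} := by
  cases n with
  | zero => exact MeasurableSet.const ([] = h)
  | succ n =>
    cases h with
    | nil => simp [pre]
    | cons e h =>
      rw [setOf_pre_trajFM_succ]
      exact Finset.measurableSet_biUnion _ fun q _ =>
        pastUnif_le _ _ (measurableSet_chooseFM M C u n h e q)

lemma real_pre_trajFM_succ (n : ℕ) (e : V × A) (h : List (V × A)) :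
    seedMeasure.real {x | pre (M.trajFM C u x) (n + 1) = e :: h} =
      ∑ q, seedMeasure.real (M.chooseFM C u n h e q) := by
  rw [setOf_pre_trajFM_succ, measureReal_biUnion_finset]
  · intro q _ q₁ _ hne
    refine Set.disjoint_left.2 fun x hx hx₁ => hne ?_
    have h1 := hx.2.symm.trans hx₁.2
    simpa using h1
  · intro q _
    exact pastUnif_le _ _ (measurableSet_chooseFM M C u n h e q)

end FiniteMemory

section Mixture

variable {V A Q : Type} [Fintype V] [Fintype A] [Fintype Q]

/-- The probability of a history. -/
def pathWeight {ι : Type*} (κ : List ι → ι → ℝ) : List ι → ℝ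
  | [] => 1
  | i :: h => pathWeight κ h * κ h i

lemma IsProc.real_pre_eq {Ω ι : Type*} [MeasurableSpace Ω] [Fintype ι] {μ : Measure Ω}
    [IsProbabilityMeasure μ] {J : Ω → ℕ → ι} {κ : List ι → ι → ℝ} (hJ : IsProc μ J κ)
    (h : List ι) : μ.real {ω | pre (J ω) h.length = h} = pathWeight κ h := by
  induction h with
  | nil => simp [pre, pathWeight]
  | cons i h ih => rw [List.length_cons, hJ.real_cons, ih, pathWeight]

variable {M : MDP V A} {t : Q → V → Q} (q₀ : Q) (c : (M.prod t).Selector → ℝ)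

/-- The first action distribution of the mixture. -/
noncomputable def mixAct (v : V) (a : A) : ℝ := ∑ d, c d * unifOn (d.1 (v, q₀)) a

open Classical in
/-- The distribution of the selector given the first state and action. -/
noncomputable def mixPost (v : V) (a : A) (d : (M.prod t).Selector) : ℝ :=
  if mixAct q₀ c v a = 0 then c d else c d * unifOn (d.1 (v, q₀)) a / mixAct q₀ c v a

variable {c} (hc : c ∈ stdSimplex ℝ (M.prod t).Selector)
include hc

lemma mixAct_nonneg (v : V) (a : A) : 0 ≤ mixAct q₀ c v a :=
  Finset.sum_nonneg fun d _ => mul_nonneg (hc.1 d) (unifOn_nonneg _ _)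

lemma mixPost_nonneg (v : V) (a : A) (d : (M.prod t).Selector) : 0 ≤ mixPost q₀ c v a d := by
  unfold mixPost
  split_ifs
  · exact hc.1 d
  · exact div_nonneg (mul_nonneg (hc.1 d) (unifOn_nonneg _ _)) (mixAct_nonneg q₀ hc _ _)

lemma sum_mixPost (v : V) (a : A) : ∑ d, mixPost q₀ c v a d = 1 := by
  unfold mixPost
  split_ifs with h
  · exact hc.2
  · rw [← Finset.sum_div]
    exact div_self h

lemma mixAct_mul_mixPost (v : V) (a : A) (d : (M.prod t).Selector) :
    mixAct q₀ c v a * mixPost q₀ c v a d = c d * unifOn (d.1 (v, q₀)) a := by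
  unfold mixPost
  split_ifs with h
  · rw [h, zero_mul]
    exact ((Finset.sum_eq_zero_iff_of_nonneg fun d _ =>
      mul_nonneg (hc.1 d) (unifOn_nonneg _ _)).1 h d (Finset.mem_univ d)).symm
  · rw [mul_div_cancel₀ _ h]

omit hc in
/-- The memory of the mixture: the chosen selector and the state of the automaton, once the
first step has been made. -/
abbrev MixMem (M : MDP V A) (t : Q → V → Q) : Type := Option ((M.prod t).Selector × Q)

omit hc in
lemma exists_mixMem_equiv (M : MDP V A) (t : Q → V → Q) :
    ∃ m : ℕ, Nonempty (Fin (m + 1) ≃ MixMem M t) := by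
  refine ⟨Fintype.card (MixMem M t) - 1, ⟨(finCongr ?_).trans (Fintype.equivFin _).symm⟩⟩
  have : 0 < Fintype.card (MixMem M t) := Fintype.card_pos
  omega

/-- The action distributions of the mixture. -/
noncomputable def mixActF (c : (M.prod t).Selector → ℝ) : MixMem M t → V → A → ℝ
  | none => mixAct q₀ c
  | some r => fun v a => unifOn (r.1.1 (v, r.2)) a

open Classical in
/-- The memory updates of the mixture. -/
noncomputable def mixUpd (c : (M.prod t).Selector → ℝ) (v : V) (a : A) :
    MixMem M t → MixMem M t → ℝ
  | none, none => 0
  | none, some r => if r.2 = t q₀ v then mixPost q₀ c v a r.1 else 0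
  | some r, s => if s = some (r.1, t r.2 v) then 1 else 0

lemma mixActF_nonneg (s : MixMem M t) (v : V) (a : A) : 0 ≤ mixActF q₀ c s v a := by
  cases s
  · exact mixAct_nonneg q₀ hc v a
  · exact unifOn_nonneg _ _

omit hc in
lemma mixActF_support (s : MixMem M t) (v : V) (a : A) (ha : a ∉ M.enabled v) :
    mixActF q₀ c s v a = 0 := by
  cases s with
  | none =>
    exact Finset.sum_eq_zero fun d _ => by
      rw [unifOn, if_neg fun h => ha ((d.2 _).2 h), mul_zero]
  | some r => exact if_neg fun h => ha ((r.1.2 _).2 h)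

lemma sum_mixActF (s : MixMem M t) (v : V) : ∑ a, mixActF q₀ c s v a = 1 := by
  cases s with
  | none =>
    simp only [mixActF, mixAct]
    rw [Finset.sum_comm]
    simp_rw [← Finset.mul_sum]
    rw [← hc.2]
    exact Finset.sum_congr rfl fun d _ => by rw [sum_unifOn (d.2 _).1, mul_one]
  | some r => exact sum_unifOn (r.1.2 _).1

lemma mixUpd_nonneg (v : V) (a : A) (s s' : MixMem M t) : 0 ≤ mixUpd q₀ c v a s s' := by
  cases s with
  | none =>
    cases s' with
    | none => exact le_rfl
    | some r =>
      simp only [mixUpd]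
      split_ifs
      exacts [mixPost_nonneg q₀ hc _ _ _, le_rfl]
  | some r =>
    simp only [mixUpd]
    split_ifs
    exacts [zero_le_one, le_rfl]

lemma sum_mixUpd (v : V) (a : A) (s : MixMem M t) : ∑ s', mixUpd q₀ c v a s s' = 1 := by
  cases s with
  | none =>
    rw [Fintype.sum_option, Fintype.sum_prod_type, ← sum_mixPost q₀ hc v a]
    simp only [mixUpd, zero_add]
    refine Finset.sum_congr rfl fun d _ => ?_
    rw [Fintype.sum_eq_single (t q₀ v) fun q hq => if_neg hq, if_pos rfl]
  | some r =>
    simp only [mixUpd]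
    rw [Fintype.sum_eq_single _ fun s hs => if_neg hs, if_pos rfl]

/-- There is a finite-memory strategy that chooses a selector at random and follows it. -/
lemma exists_mixFinMem : ∃ (C : M.FinMem) (e : Fin (C.m + 1) ≃ MixMem M t),
    e C.init = none ∧ (∀ q v a, C.actF q v a = mixActF q₀ c (e q) v a) ∧
      ∀ q v a v' q', C.upd q v a v' q' = mixUpd q₀ c v a (e q) (e q') := by
  obtain ⟨m, ⟨e⟩⟩ := exists_mixMem_equiv M t
  exact ⟨{
    m := m
    init := e.symm none
    actF := fun q v a => mixActF q₀ c (e q) v a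
    actF_nonneg := fun q v a => mixActF_nonneg q₀ hc _ _ _
    actF_support := fun q v a ha => mixActF_support q₀ _ _ _ ha
    actF_sum := fun q v => sum_mixActF q₀ hc _ _
    upd := fun q v a _ q' => mixUpd q₀ c v a (e q) (e q')
    upd_nonneg := fun q v a _ q' => mixUpd_nonneg q₀ hc _ _ _ _
    upd_sum := fun q v a _ => by
      rw [e.sum_comp (mixUpd q₀ c v a (e q))]
      exact sum_mixUpd q₀ hc v a _ }, e, e.apply_symm_apply _, fun _ _ _ => rfl,
    fun _ _ _ _ _ => rfl⟩

omit hc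

open Classical in
/-- The joint probability of a history and a memory value under the mixture. -/
noncomputable def mixJoint (c : (M.prod t).Selector → ℝ) (α : V → ℝ) :
    List (V × A) → MixMem M t → ℝ
  | [r], none => α r.1 * mixAct q₀ c r.1 r.2
  | r :: e :: h, some s => if s.2 = memAt t q₀ (e :: h) then
      c s.1 * pathWeight (stepKernel M (s.1.memStrategy q₀) α) (r :: e :: h) else 0
  | _, _ => 0

lemma sum_mixJoint (α : V → ℝ) (r : V × A) (h : List (V × A)) :
    ∑ s, mixJoint q₀ c α (r :: h) s =
      ∑ d, c d * pathWeight (stepKernel M (d.memStrategy q₀) α) (r :: h) := by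
  rw [Fintype.sum_option]
  cases h with
  | nil =>
    simp only [mixJoint, Finset.sum_const_zero, add_zero, pathWeight, stepKernel, nextState,
      mixAct, Selector.memStrategy, memAt, one_mul]
    rw [Finset.mul_sum]
    exact Finset.sum_congr rfl fun d _ => by ring
  | cons e h =>
    simp only [mixJoint, zero_add]
    rw [Fintype.sum_prod_type]
    refine Finset.sum_congr rfl fun d _ => ?_
    rw [Fintype.sum_eq_single (memAt t q₀ (e :: h)) fun q hq => if_neg hq, if_pos rfl]

include hc in
lemma mixJoint_cons_cons (α : V → ℝ) (r f : V × A) (h : List (V × A)) (s : MixMem M t) :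
    (∑ s', mixJoint q₀ c α (f :: h) s' * M.p f.1 f.2 r.1 * mixUpd q₀ c f.1 f.2 s' s) *
      mixActF q₀ c s r.1 r.2 = mixJoint q₀ c α (r :: f :: h) s := by
  cases s with
  | none =>
    have h0 : ∀ s' : MixMem M t, mixUpd q₀ c f.1 f.2 s' none = 0 := by
      rintro (_ | s')
      · rfl
      · simp [mixUpd]
    simp [h0, mixJoint]
  | some s =>
    obtain ⟨d, q⟩ := s
    cases h with
    | nil =>
      rw [Fintype.sum_option]
      have h1 : memAt t q₀ [f] = t q₀ f.1 := rfl
      simp only [mixJoint, mixUpd, mixActF, zero_mul, Finset.sum_const_zero, add_zero, h1]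
      by_cases hq : q = t q₀ f.1
      · subst hq
        rw [if_pos rfl, if_pos h1.symm]
        simp only [pathWeight, stepKernel, nextState, Selector.memStrategy, memAt]
        linear_combination α f.1 * M.p f.1 f.2 r.1 * unifOn (d.1 (r.1, t q₀ f.1)) r.2 *
          mixAct_mul_mixPost q₀ hc f.1 f.2 d
      · rw [if_neg hq, if_neg fun h' => hq (h'.trans h1), mul_zero, zero_mul]
    | cons g h =>
      rw [Fintype.sum_eq_single (some (d, memAt t q₀ (g :: h)))]
      · have h1 : memAt t q₀ (f :: g :: h) = t (memAt t q₀ (g :: h)) f.1 := rfl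
        simp only [mixJoint, mixUpd, mixActF, if_true]
        by_cases hq : q = t (memAt t q₀ (g :: h)) f.1
        · subst hq
          rw [if_pos rfl, if_pos h1.symm, pathWeight.eq_def _ (r :: f :: g :: h)]
          simp only [stepKernel, nextState, Selector.memStrategy, h1]
          ring
        · rw [if_neg (fun h' => hq (by simpa using h')), if_neg fun h' => hq (h'.trans h1),
            mul_zero, zero_mul]
      · rintro (_ | ⟨d', q'⟩) hs
        · simp [mixJoint]
        · by_cases hq' : q' = memAt t q₀ (g :: h)
          · subst hq'
            have hd : d ≠ d' := fun h' => hs (by rw [h'])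
            have h0 : mixUpd q₀ c f.1 f.2 (some (d', memAt t q₀ (g :: h))) (some (d, q)) = 0 :=
              if_neg (by simp [hd])
            rw [h0, mul_zero]
          · have h0 : mixJoint q₀ c α (f :: g :: h) (some (d', q')) = 0 := if_neg hq'
            rw [h0, zero_mul, zero_mul]

variable [DecidableEq V] [Nonempty V] [Nonempty A]

section

variable {C : M.FinMem} {e : Fin (C.m + 1) ≃ MixMem M t} (hinit : e C.init = none)
  (hact : ∀ q v a, C.actF q v a = mixActF q₀ c (e q) v a)
  (hupd : ∀ q v a v' q', C.upd q v a v' q' = mixUpd q₀ c v a (e q) (e q'))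
include hc hinit hact hupd

lemma real_chooseFM_mix (u : V) (h : List (V × A)) (r : V × A) (q : Fin (C.m + 1)) :
    seedMeasure.real (M.chooseFM C u h.length h r q) =
      mixJoint q₀ c (diracD u) (r :: h) (e q) := by
  induction h generalizing r q with
  | nil =>
    have h1 : M.arriveFM C u ([] : List (V × A)).length [] r.1 q =
        {_x | u = r.1 ∧ C.init = q} := by
      ext x
      simp [arriveFM, pre, runFM]
    rw [real_chooseFM, h1, hact]
    by_cases hq : C.init = q
    · subst hq
      rw [hinit]
      by_cases hu : u = r.1
      · simp [hu, mixJoint, mixActF, diracD]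
      · simp [hu, Ne.symm hu, mixJoint, diracD]
    · have h2 : e q ≠ none := fun h' => hq (e.injective (hinit.trans h'.symm))
      obtain ⟨s, hs⟩ := Option.ne_none_iff_exists'.1 h2
      simp [hq, hs, mixJoint]
  | cons f h ih =>
    rw [real_chooseFM, List.length_cons, real_arriveFM_succ, hact]
    simp_rw [ih, hupd]
    rw [e.sum_comp fun s => mixJoint q₀ c (diracD u) (f :: h) s * M.p f.1 f.2 r.1 *
      mixUpd q₀ c f.1 f.2 s (e q), mixJoint_cons_cons q₀ hc]

lemma real_pre_trajFM_mix (u : V) (n : ℕ) (l : List (V × A)) :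
    seedMeasure.real {x | pre (M.trajFM C u x) n = l} = ∑ d, c d *
      seedMeasure.real {x | pre (M.traj (d.memStrategy q₀) (diracD u) x) n = l} := by
  by_cases hl : l.length = n
  · subst hl
    cases l with
    | nil =>
      simp [pre, hc.2]
    | cons r h =>
      rw [List.length_cons, real_pre_trajFM_succ]
      simp_rw [real_chooseFM_mix q₀ hc hinit hact hupd]
      rw [e.sum_comp, sum_mixJoint]
      exact Finset.sum_congr rfl fun d _ => by
        rw [← (isProc_traj (d.memStrategy q₀) u).real_pre_eq (r :: h), List.length_cons]
  · have h0 : ∀ f : ℕ → V × A, pre f n ≠ l := fun f hf => hl (by rw [← hf, length_pre])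
    simp [h0]

end

lemma measurable_of_pre {Ω ι : Type*} [MeasurableSpace Ω] [Countable ι] [MeasurableSpace ι]
    [MeasurableSingletonClass ι] {J : Ω → ℕ → ι}
    (hJ : ∀ n l, MeasurableSet {ω | pre (J ω) n = l}) : Measurable J := by
  refine measurable_pi_lambda _ fun n => measurable_to_countable' fun i => ?_
  have : (fun ω => J ω n) ⁻¹' {i} = ⋃ l, {ω | pre (J ω) (n + 1) = i :: l} := by
    ext ω; simp [pre]
  rw [this]
  exact MeasurableSet.iUnion fun l => hJ _ _

lemma real_preimage_eq_sum_of_pre {Ω ι D : Type*} [MeasurableSpace Ω] [Fintype ι] [Fintype D]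
    [MeasurableSpace ι] [MeasurableSingletonClass ι] {μ : Measure Ω} [IsProbabilityMeasure μ]
    {J : Ω → ℕ → ι} {K : D → Ω → ℕ → ι} {c : D → ℝ} (hc : c ∈ stdSimplex ℝ D)
    (hJ : ∀ n l, MeasurableSet {ω | pre (J ω) n = l})
    (hK : ∀ d n l, MeasurableSet {ω | pre (K d ω) n = l})
    (h : ∀ n l, μ.real {ω | pre (J ω) n = l} = ∑ d, c d * μ.real {ω | pre (K d ω) n = l})
    {B : Set (ℕ → ι)} (hB : MeasurableSet B) :
    μ.real (J ⁻¹' B) = ∑ d, c d * μ.real (K d ⁻¹' B) := by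
  have hmJ := measurable_of_pre hJ
  have hmK := fun d => measurable_of_pre (hK d)
  have hprob : ∀ d, IsProbabilityMeasure (μ.map (K d)) := fun d =>
    Measure.isProbabilityMeasure_map (hmK d).aemeasurable
  have : IsProbabilityMeasure (μ.map J) := Measure.isProbabilityMeasure_map hmJ.aemeasurable
  let ν : Measure (ℕ → ι) := ∑ d, ENNReal.ofReal (c d) • μ.map (K d)
  have hν : ∀ E, MeasurableSet E → ν.real E = ∑ d, c d * μ.real (K d ⁻¹' E) := by
    intro E hE
    simp only [ν, Measure.real, Measure.coe_finsetSum, Finset.sum_apply, Measure.smul_apply,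
      smul_eq_mul]
    rw [ENNReal.toReal_sum fun d _ => ENNReal.mul_ne_top ENNReal.ofReal_ne_top (measure_ne_top _ _)]
    exact Finset.sum_congr rfl fun d _ => by
      rw [ENNReal.toReal_mul, ENNReal.toReal_ofReal (hc.1 d), Measure.map_apply (hmK d) hE]
  have : IsProbabilityMeasure ν := by
    constructor
    simp only [ν, Measure.coe_finsetSum, Finset.sum_apply, Measure.smul_apply, smul_eq_mul,
      measure_univ, mul_one]
    rw [← ENNReal.ofReal_sum_of_nonneg fun d _ => hc.1 d, hc.2, ENNReal.ofReal_one]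
  have heq : μ.map J = ν := measure_ext_of_pre fun n l => by
    rw [hν _ (measurableSet_pre_eq n l), map_measureReal_apply hmJ (measurableSet_pre_eq n l)]
    exact h n l
  rw [← map_measureReal_apply hmJ hB, heq, hν B hB]

lemma measurableSet_label_mem {S : Type} {L : Set (ℕ → S)} {step : Q → S → Q}
    {acc : Set Q → Prop} (hL : ∀ w, w ∈ L ↔ acc (infSet (detRun q₀ step w))) (ℓ : V → S)
    [MeasurableSpace (V × A)] [MeasurableSingletonClass (V × A)] :
    MeasurableSet {f : ℕ → V × A | (fun n => ℓ (f n).1) ∈ L} := by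
  have hset : {f : ℕ → V × A | (fun n => ℓ (f n).1) ∈ L} =
      {f | acc (infSet fun n => memAt (fun q v => step q (ℓ v)) q₀ (pre f n))} := by
    ext f
    simp only [Set.mem_ofPred_eq, hL, memAt_pre_eq_detRun]
  rw [hset]
  let _ : MeasurableSpace Prop := ⊤
  refine measurableSet_setOfPred.2 (measurable_infSet (fun n q => ?_) acc)
  have : {f : ℕ → V × A | memAt (fun q v => step q (ℓ v)) q₀ (pre f n) = q} =
      ⋃ l ∈ {l : List (V × A) | memAt (fun q v => step q (ℓ v)) q₀ l = q}, {f | pre f n = l} := by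
    ext f; simp
  rw [this]
  exact MeasurableSet.biUnion (Set.to_countable _) fun l _ => measurableSet_pre_eq n l

lemma PrEventFM_eq (C : M.FinMem) (u : V) (E : Set (ℕ → V)) : M.PrEventFM C u E =
    seedMeasure.real {x | (fun n => (M.runFM C u x n).1.1) ∈ E} := by
  rw [PrEventFM, Measure.real, seedMeasure, Measure.restrict_apply' measurableSet_Icc,
    Set.inter_comm]
  rfl

theorem exists_finMem_mixture {S : Type} {k : ℕ} {L : Fin k → Set (ℕ → S)} {step : Q → S → Q}
    {acc : Fin k → Set Q → Prop} (hL : ∀ i w, w ∈ L i ↔ acc i (infSet (detRun q₀ step w)))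
    (u : V) (ℓ : V → S) {c : (M.prod fun q v => step q (ℓ v)).Selector → ℝ}
    (hc : c ∈ stdSimplex ℝ (M.prod fun q v => step q (ℓ v)).Selector) :
    ∃ C : M.FinMem, ∀ i,
      M.PrOmegaFM C u ℓ (L i) = ∑ d, c d * M.PrOmega (d.memStrategy q₀) u ℓ (L i) := by
  obtain ⟨C, e, hinit, hact, hupd⟩ := exists_mixFinMem q₀ hc
  refine ⟨C, fun i => ?_⟩
  let _ : MeasurableSpace (V × A) := ⊤
  have h := real_preimage_eq_sum_of_pre
    (K := fun d => M.traj (Selector.memStrategy q₀ d) (diracD u))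
    hc (measurableSet_pre_trajFM M C u) (fun d => (isProc_traj (d.memStrategy q₀) u).meas)
    (real_pre_trajFM_mix q₀ hc hinit hact hupd u) (measurableSet_label_mem q₀ (hL i) ℓ)
  rw [PrOmegaFM, PrEventFM_eq]
  refine h.trans (Finset.sum_congr rfl fun d _ => ?_)
  rw [PrOmega, PrEvent_eq]
  rfl

end Mixture

end MDP

open MDP in
/-- Let `B` be a boolean combination (given by a truth-functional connective `f`) of
predicates `Pr^σ_u(φ_i) Δ_i p_i`, where the `φ_i` are ω-regular and `p_i ∈ [0,1]`.
If some strategy satisfies `B`, then some strategy implementable with a finite amount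
of memory satisfies `B`: a randomized strategy whose action distribution depends only
on the current state and a memory value from a finite set, updated (possibly randomly)
along the trajectory. -/
theorem multi_objective_query_finite_memory_suffices
    {V A S : Type} [Fintype V] [Fintype A] [Fintype S]
    [Nonempty V] [Nonempty A] [DecidableEq V]
    (M : MDP V A) (ℓ : V → S) (u : V) {k : ℕ}
    (L : Fin k → Set (ℕ → S)) (hL : ∀ i, IsOmegaRegular (L i))
    (c : Fin k → Cmp) (p : Fin k → ℝ) (hp : ∀ i, 0 ≤ p i ∧ p i ≤ 1)
    (f : (Fin k → Prop) → Prop)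
    (hf : ∀ P Q : Fin k → Prop, (∀ i, P i ↔ Q i) → (f P ↔ f Q))
    (hex : ∃ σ : M.Strategy, f fun i => (c i).rel (M.PrOmega σ u ℓ (L i)) (p i)) :
    ∃ C : M.FinMem, f fun i => (c i).rel (M.PrOmegaFM C u ℓ (L i)) (p i) := by
  obtain ⟨σ, hσ⟩ := hex
  obtain ⟨Q, _, q₀, step, acc, hacc⟩ := OmegaWord.exists_muller_family hL
  obtain ⟨w, hw, hwσ⟩ := MDP.exists_mixture hacc σ u ℓ
  obtain ⟨C, hC⟩ := MDP.exists_finMem_mixture q₀ hacc u ℓ hw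
  refine ⟨C, (hf _ _ fun i => ?_).1 hσ⟩
  rw [hC, hwσ]
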